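/- arXiv:2512.12316 — 2 statements merged into one kernel-verified Lean document; each statement's English description precedes it below -/
import Mathlib

section
/- Let F ∈ ℂ[X,Y,Z] be an irreducible homogeneous polynomial of degree d ≥ 3 whose curve F = 0 has only nodes as singularities, let Δ be the set of nodes, n = |Δ| ≤ binom(d−1,2) − 1. Let F₁, F₂ be linearly independent elements of the span of F_X, F_Y, F_Z whose common zero set in ℙ² equals Δ ∪ Σ, where Σ is a set of exactly (d−1)² − n distinct points disjoint from Δ. Then there is a partition Σ = Z ⊔ Y with |Z| = binom(d,2) − n and |Y| = binom(d−1,2) such that: (a) the only homogeneous polynomial of degree d − 2 vanishing at every point of Z ∪ Δ is 0, and (b) the only homogeneous polynomial of degree d − 3 vanishing at every point of Y is 0. -/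
open MvPolynomial

noncomputable section

/-- The complex projective plane. -/
abbrev P2 : Type := Projectivization ℂ (Fin 3 → ℂ)

/-- A (homogeneous) polynomial `G` vanishes at a point `p ∈ ℙ²`. -/
def VanAt (G : MvPolynomial (Fin 3) ℂ) (p : P2) : Prop :=
  eval p.rep G = 0

/-- The submodule of polynomials vanishing at every point of `S`. -/
def vanishing (S : Set P2) : Submodule ℂ (MvPolynomial (Fin 3) ℂ) where
  carrier := {G | ∀ p ∈ S, VanAt G p}
  add_mem' := by
    intro a b ha hb p hp
    have h1 := ha p hp
    have h2 := hb p hp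
    simp only [VanAt] at h1 h2 ⊢
    simp [h1, h2]
  zero_mem' := by
    intro p hp
    simp [VanAt]
  smul_mem' := by
    intro c G hG p hp
    have h1 := hG p hp
    simp only [VanAt] at h1 ⊢
    simp [h1]

/-- `V_k(S)`: homogeneous polynomials of degree `k` (together with `0`)
vanishing at every point of `S`. -/
def Vsp (k : ℕ) (S : Set P2) : Submodule ℂ (MvPolynomial (Fin 3) ℂ) :=
  homogeneousSubmodule (Fin 3) ℂ k ⊓ vanishing S

/-- `p` is a singular point of the curve `F = 0`. -/
def SingPt (F : MvPolynomial (Fin 3) ℂ) (p : P2) : Prop :=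
  ∀ i : Fin 3, eval p.rep (pderiv i F) = 0

/-- `p` is a node of the curve `F = 0`. -/
def IsNode (F : MvPolynomial (Fin 3) ℂ) (p : P2) : Prop :=
  SingPt F p ∧
    (Matrix.of fun i j : Fin 3 => eval p.rep (pderiv i (pderiv j F))).rank = 2

/-- The curve `F = 0` is nodal: every singular point is a node. -/
def Nodal (F : MvPolynomial (Fin 3) ℂ) : Prop :=
  ∀ p : P2, SingPt F p → IsNode F p

/-- The set of nodes of the curve `F = 0`. -/
def nodes (F : MvPolynomial (Fin 3) ℂ) : Set P2 :=
  {p | IsNode F p}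

/-- The common zero set in `ℙ²` of two polynomials. -/
def zeroSet (F₁ F₂ : MvPolynomial (Fin 3) ℂ) : Set P2 :=
  {p | VanAt F₁ p ∧ VanAt F₂ p}


/-- component of degree `N` of a product with a homogeneous polynomial -/
theorem comp_mul {σ : Type*} (f A : MvPolynomial σ ℂ) (m N : ℕ) (hA : A.IsHomogeneous m) :
    homogeneousComponent N (f * A) =
      (if m ≤ N then homogeneousComponent (N - m) f else 0) * A := by
  conv_lhs => rw [← sum_homogeneousComponent f, Finset.sum_mul, map_sum]
  have key : ∀ i, homogeneousComponent N (homogeneousComponent i f * A) =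
      if i + m = N then homogeneousComponent i f * A else 0 := by
    intro i
    rw [homogeneousComponent_of_mem (m := N) (n := i + m)]
    · simp [eq_comm]
    · exact (homogeneousComponent_isHomogeneous i f).mul hA
  simp only [key]
  by_cases h : m ≤ N
  · simp only [h, if_true]
    by_cases h2 : N - m ≤ f.totalDegree
    · rw [Finset.sum_eq_single (N - m)]
      · simp [Nat.sub_add_cancel h]
      · intro b _ hb
        rw [if_neg]; omega
      · intro h3
        exfalso; apply h3; simp; omega
    · rw [homogeneousComponent_eq_zero (N - m) f (by omega), zero_mul]
      apply Finset.sum_eq_zero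
      intro i hi
      rw [Finset.mem_range] at hi
      rw [if_neg]; omega
  · simp only [h, if_false, zero_mul]
    apply Finset.sum_eq_zero
    intro i hi
    rw [if_neg]; omega

/-- truncated component -/
def tc {σ : Type*} (f : MvPolynomial σ ℂ) (m N : ℕ) : MvPolynomial σ ℂ :=
  if m ≤ N then homogeneousComponent (N - m) f else 0

theorem tc_hom {σ : Type*} (f : MvPolynomial σ ℂ) (m N : ℕ) : (tc f m N).IsHomogeneous (N - m) := by
  unfold tc
  split_ifs
  · exact homogeneousComponent_isHomogeneous _ _
  · exact isHomogeneous_zero _ _ _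

theorem tc_lt {σ : Type*} (f : MvPolynomial σ ℂ) (m N : ℕ) (h : N < m) : tc f m N = 0 := by
  unfold tc
  rw [if_neg]; omega

theorem comp_mul_tc {σ : Type*} (f A : MvPolynomial σ ℂ) (m N : ℕ) (hA : A.IsHomogeneous m) :
    homogeneousComponent N (f * A) = tc f m N * A := comp_mul f A m N hA

theorem hom_decomp {σ : Type*} {h a b A B : MvPolynomial σ ℂ} {N m n : ℕ}
    (hh : h.IsHomogeneous N) (hA : A.IsHomogeneous m) (hB : B.IsHomogeneous n)
    (e : h = a * A + b * B) : h = tc a m N * A + tc b n N * B := by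
  rw [← comp_mul_tc a A m N hA, ← comp_mul_tc b B n N hB, ← map_add, ← e]
  exact (homogeneousComponent_eq_self hh).symm

theorem dvd_hom_lt {σ : Type*} {F u : MvPolynomial σ ℂ} {m n : ℕ}
    (hF : F.IsHomogeneous m) (hu : u.IsHomogeneous n) (h : n < m) (hd : F ∣ u) : u = 0 := by
  obtain ⟨c, hc⟩ := hd
  have := hom_decomp (a := c) (b := 0) (B := 0) (n := m) hu hF (isHomogeneous_zero _ _ _)
    (by rw [hc]; ring)
  rw [tc_lt _ _ _ h] at this
  simpa using this

theorem hom_eval_zero {σ : Type*} {F : MvPolynomial σ ℂ} {m : ℕ}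
    (hF : F.IsHomogeneous m) (hm : m ≠ 0) : eval 0 F = 0 := by
  have h : coeff 0 F = 0 := hF.coeff_eq_zero (by simpa using hm.symm)
  have : eval (0 : σ → ℂ) F = constantCoeff F := by
    simp [eval, eval₂Hom_zero]
  rw [this, constantCoeff_eq, h]

theorem hom_eval_smul {σ : Type*} {F : MvPolynomial σ ℂ} {m : ℕ}
    (hF : F.IsHomogeneous m) (c : ℂ) (v : σ → ℂ) : eval (c • v) F = c ^ m * eval v F := by
  rw [eval_eq, eval_eq, Finset.mul_sum]
  apply Finset.sum_congr rfl
  intro s hs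
  have h1 := hF.degree_eq_sum_deg_support hs
  simp only [Pi.smul_apply, smul_eq_mul, mul_pow, Finset.prod_mul_distrib, Finset.prod_pow_eq_pow_sum]
  rw [h1]
  ring_nf

/-- the linear form with coefficients `a` -/
def lin (a : Fin 3 → ℂ) : MvPolynomial (Fin 3) ℂ := ∑ i, C (a i) * X i

theorem lin_hom (a : Fin 3 → ℂ) : (lin a).IsHomogeneous 1 :=
  IsHomogeneous.sum _ _ _ fun _ _ => isHomogeneous_C_mul_X _ _

theorem lin_eval (a v : Fin 3 → ℂ) : eval v (lin a) = ∑ i, a i * v i := by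
  simp [lin]

/-- restriction to the line `lin a = 0` -/
def phi (a : Fin 3 → ℂ) : MvPolynomial (Fin 3) ℂ →ₐ[ℂ] MvPolynomial (Fin 2) ℂ :=
  aeval ![X 0, X 1, C (-(a 0 / a 2)) * X 0 + C (-(a 1 / a 2)) * X 1]

def psi : MvPolynomial (Fin 2) ℂ →ₐ[ℂ] MvPolynomial (Fin 3) ℂ :=
  aeval ![X 0, X 1]

theorem phi_psi (a : Fin 3 → ℂ) (f) : phi a (psi f) = f := by
  have : (phi a).comp psi = AlgHom.id ℂ _ := by
    ext i
    fin_cases i <;> simp [phi, psi]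
  exact DFunLike.congr_fun this f

theorem phi_lin (a : Fin 3 → ℂ) (h : a 2 ≠ 0) : phi a (lin a) = 0 := by
  simp only [phi, lin, Fin.sum_univ_three, map_add, map_mul, aeval_X, algHom_C, algebraMap_eq]
  simp only [Matrix.cons_val]
  have h0 : C (a 2) * C (-(a 0 / a 2)) = -(C (a 0) : MvPolynomial (Fin 2) ℂ) := by
    rw [← C_mul, ← C_neg]; congr 1; field_simp
  have h1 : C (a 2) * C (-(a 1 / a 2)) = -(C (a 1) : MvPolynomial (Fin 2) ℂ) := by
    rw [← C_mul, ← C_neg]; congr 1; field_simp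
  linear_combination X 0 * h0 + X 1 * h1

theorem phi_hom (a : Fin 3 → ℂ) {f} {n : ℕ} (hf : f.IsHomogeneous n) :
    (phi a f).IsHomogeneous n := by
  have := hf.aeval ![X 0, X 1, C (-(a 0 / a 2)) * X 0 + C (-(a 1 / a 2)) * X 1]
    (n := 1) (S := ℂ) (τ := Fin 2) ?_
  · simpa [phi] using this
  · intro i
    fin_cases i
    · exact isHomogeneous_X _ _
    · exact isHomogeneous_X _ _
    · exact (isHomogeneous_C_mul_X _ _).add (isHomogeneous_C_mul_X _ _)

theorem psi_phi (a : Fin 3 → ℂ) (h : a 2 ≠ 0) (f) : lin a ∣ f - psi (phi a f) := by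
  rw [← Ideal.mem_span_singleton, ← Ideal.Quotient.eq]
  let q := Ideal.Quotient.mkₐ ℂ (Ideal.span {lin a})
  have : q = (q.comp psi).comp (phi a) := by
    ext i
    fin_cases i
    · simp [phi, psi, q]
    · simp [phi, psi, q]
    · simp only [AlgHom.comp_apply]
      apply Ideal.Quotient.eq.2
      rw [Ideal.mem_span_singleton]
      refine ⟨C (1 / a 2), ?_⟩
      simp only [phi, psi, lin, Fin.sum_univ_three]
      simp only [Fin.reduceFinMk, aeval_X, Matrix.cons_val, map_add, map_mul, algHom_C, algebraMap_eq]
      have h0 : C (a 0) * C (1 / a 2) = -(C (-(a 0 / a 2)) : MvPolynomial (Fin 3) ℂ) := by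
        rw [← C_mul, ← C_neg]; congr 1; field_simp
      have h1 : C (a 1) * C (1 / a 2) = -(C (-(a 1 / a 2)) : MvPolynomial (Fin 3) ℂ) := by
        rw [← C_mul, ← C_neg]; congr 1; field_simp
      have h2 : C (a 2) * C (1 / a 2) = (1 : MvPolynomial (Fin 3) ℂ) := by
        rw [← C_mul, ← C_1]; congr 1; field_simp
      linear_combination -X 0 * h0 - X 1 * h1 - X 2 * h2
  exact DFunLike.congr_fun this f

theorem phi_ker (a : Fin 3 → ℂ) (h : a 2 ≠ 0) {f} (hf : phi a f = 0) : lin a ∣ f := by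
  have := psi_phi a h f
  simpa [hf] using this

theorem lin_ne (a : Fin 3 → ℂ) (h : a 2 ≠ 0) : lin a ≠ 0 := by
  intro h0
  have : eval ![0,0,1] (lin a) = 0 := by rw [h0]; simp
  rw [lin_eval] at this
  simp [Fin.sum_univ_three] at this
  exact h this

theorem nullst (I : Ideal (MvPolynomial (Fin 3) ℂ)) (l : MvPolynomial (Fin 3) ℂ)
    (h : ∀ v, (∀ f ∈ I, eval v f = 0) → eval v l = 0) : ∃ N : ℕ, l ^ N ∈ I := by
  have : l ∈ I.radical := by
    rw [← vanishingIdeal_zeroLocus_eq_radical (K := ℂ)]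
    intro x hx
    exact h x hx
  exact this

theorem relprime_X : IsRelPrime (X 0 : MvPolynomial (Fin 2) ℂ) (X 1) := by
  have h0 : Irreducible (X 0 : MvPolynomial (Fin 2) ℂ) := (X_prime (R := ℂ) (i := (0 : Fin 2))).irreducible
  rw [Irreducible.isRelPrime_iff_not_dvd h0]
  intro h
  obtain ⟨c, hc⟩ := h
  have := congrArg (eval ![0, 1]) hc
  simp at this

/-- A common divisor mod `lin a` of an ideal whose zero set meets the plane only in 0. -/
theorem rp_mod (a : Fin 3 → ℂ) (h2 : a 2 ≠ 0) (K : Ideal (MvPolynomial (Fin 3) ℂ))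
    (hK : ∀ v, (∀ f ∈ K, eval v f = 0) → eval v (lin a) = 0 → v = 0)
    (π : MvPolynomial (Fin 2) ℂ) (hπ : ∀ f ∈ K, π ∣ phi a f) : IsUnit π := by
  have key : ∀ i, ∃ N : ℕ, π ∣ phi a (X i ^ N) := by
    intro i
    obtain ⟨N, hN⟩ := nullst (K ⊔ Ideal.span {lin a}) (X i) (by
      intro v hv
      have : v = 0 := hK v (fun f hf => hv f (Ideal.mem_sup_left hf))
        (hv _ (Ideal.mem_sup_right (Ideal.mem_span_singleton_self _)))
      simp [this])
    refine ⟨N, ?_⟩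
    obtain ⟨y, hy, z, hz, hyz⟩ := Submodule.mem_sup.1 hN
    obtain ⟨c, rfl⟩ := Ideal.mem_span_singleton.1 hz
    rw [← hyz]
    simp only [map_add, map_mul, phi_lin a h2, zero_mul, add_zero]
    exact hπ y hy
  obtain ⟨N, hN⟩ := key 0
  obtain ⟨M, hM⟩ := key 1
  have : IsRelPrime ((X 0 : MvPolynomial (Fin 2) ℂ) ^ N) (X 1 ^ M) := relprime_X.pow
  refine this ?_ ?_
  · simpa [phi] using hN
  · simpa [phi] using hM

/-- Syzygies mod a pair with coprime restriction. -/
theorem syz_step (a : Fin 3 → ℂ) (h2 : a 2 ≠ 0) {F H x y : MvPolynomial (Fin 3) ℂ}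
    (hrp : IsRelPrime (phi a F) (phi a H)) (hH : phi a H ≠ 0)
    (e : phi a (x * F + y * H) = 0) :
    ∃ w x' y', x = w * H + lin a * x' ∧ y = -w * F + lin a * y' := by
  simp only [map_add, map_mul] at e
  have hd : phi a H ∣ phi a x := by
    apply hrp.symm.dvd_of_dvd_mul_right
    exact ⟨-phi a y, by linear_combination e⟩
  obtain ⟨w, hw⟩ := hd
  have hy : phi a y = -w * phi a F := by
    apply mul_right_cancel₀ hH
    rw [hw] at e
    linear_combination e
  obtain ⟨x', hx'⟩ := phi_ker a h2 (f := x - psi w * H) (by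
    simp only [map_sub, map_mul, phi_psi, hw]; ring)
  obtain ⟨y', hy'⟩ := phi_ker a h2 (f := y + psi w * F) (by
    simp only [map_add, map_mul, phi_psi, hy]; ring)
  exact ⟨psi w, x', y', by linear_combination hx', by linear_combination hy'⟩

theorem nzd (a : Fin 3 → ℂ) (h2 : a 2 ≠ 0) {F H f : MvPolynomial (Fin 3) ℂ}
    (hrp : IsRelPrime (phi a F) (phi a H)) (hH : phi a H ≠ 0) (N : ℕ)
    (h : lin a ^ N * f ∈ Ideal.span {F, H}) : f ∈ Ideal.span {F, H} := by
  induction N with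
  | zero => simpa using h
  | succ N ih =>
    apply ih
    obtain ⟨x, y, hxy⟩ := Ideal.mem_span_pair.1 h
    obtain ⟨w, x', y', hx, hy⟩ := syz_step a h2 (x := x) (y := y) hrp hH (by
      rw [hxy, pow_succ]; simp [phi_lin a h2])
    rw [Ideal.mem_span_pair]
    refine ⟨x', y', ?_⟩
    apply mul_left_cancel₀ (lin_ne a h2)
    rw [hx, hy] at hxy
    linear_combination hxy

/-- Koszul syzygies of a pair. -/
theorem koszul (a : Fin 3 → ℂ) (h2 : a 2 ≠ 0) {F H x y : MvPolynomial (Fin 3) ℂ} {m k : ℕ}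
    (hrp : IsRelPrime (phi a F) (phi a H)) (hH : phi a H ≠ 0) (hHm : H.IsHomogeneous m)
    (hx : x.IsHomogeneous k)
    (e : x * F + y * H = 0) : ∃ w, x = tc w m k * H := by
  have key : ∀ N : ℕ, ∃ w x' y', x = w * H + lin a ^ N * x' ∧ x' * F + y' * H = 0 := by
    intro N
    induction N with
    | zero => exact ⟨0, x, y, by ring, e⟩
    | succ N ih =>
      obtain ⟨w, x', y', h1, h3⟩ := ih
      obtain ⟨w1, x1, y1, hx1, hy1⟩ := syz_step a h2 (x := x') (y := y') hrp hH (by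
        rw [h3, map_zero])
      refine ⟨w + lin a ^ N * w1, x1, y1, ?_, ?_⟩
      · rw [h1, hx1]; ring
      · apply mul_left_cancel₀ (lin_ne a h2)
        rw [hx1, hy1] at h3
        linear_combination h3
  obtain ⟨w, x', y', h1, _⟩ := key (k + 1)
  refine ⟨w, ?_⟩
  have := hom_decomp (a := w) (b := x') (B := lin a ^ (k+1)) (n := 1 * (k+1)) hx hHm
    ((lin_hom a).pow _) (by rw [h1]; ring)
  rw [tc_lt x' (1 * (k+1)) k (by omega)] at this
  simpa using this

theorem choose_two_aux (k : ℕ) : 2 * (k + 2).choose 2 = (k + 2) * (k + 1) := by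
  have := Nat.add_one_mul_choose_eq (k + 1) 1
  simp at this
  lia

theorem card_deg (t : ℕ) : Nat.card {d : Fin 3 →₀ ℕ | d.degree = t} = (t + 2).choose 2 := by
  have e : {d : Fin 3 →₀ ℕ | d.degree = t} ≃ Sym (Fin 3) t := by
    refine Equiv.trans (Equiv.subtypeEquivRight ?_) (Sym.equivNatSum (Fin 3) t).symm
    intro x
    simp [Finsupp.degree, Finsupp.sum]
    rfl
  rw [Nat.card_congr e, Nat.card_eq_fintype_card, Sym.card_sym_eq_choose]
  simp only [Fintype.card_fin]
  rw [show 3 + t - 1 = t + 2 by omega, ← Nat.choose_symm_add]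

instance (t : ℕ) : FiniteDimensional ℂ (homogeneousSubmodule (Fin 3) ℂ t) :=
  Module.Finite.iff_fg.2 (homogeneousSubmodule_fg _ _ t)

theorem finrank_hom (t : ℕ) :
    Module.finrank ℂ (homogeneousSubmodule (Fin 3) ℂ t) = (t + 2).choose 2 := by
  rw [homogeneousSubmodule_eq_finsupp_supported]
  rw [LinearEquiv.finrank_eq (AddMonoidAlgebra.supportedEquivFinsupp {d : Fin 3 →₀ ℕ | d.degree = t})]
  rw [← card_deg]
  have : Finite {d : Fin 3 →₀ ℕ | d.degree = t} := by
    apply Nat.finite_of_card_ne_zero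
    rw [card_deg]
    exact (Nat.choose_pos (by omega)).ne'
  have := Fintype.ofFinite {d : Fin 3 →₀ ℕ | d.degree = t}
  rw [Module.finrank_finsupp_self, Nat.card_eq_fintype_card]

theorem van_mk {G : MvPolynomial (Fin 3) ℂ} {n : ℕ} (hG : G.IsHomogeneous n)
    (v : Fin 3 → ℂ) (hv : v ≠ 0) : VanAt G (Projectivization.mk ℂ v hv) ↔ eval v G = 0 := by
  obtain ⟨c, hc⟩ := Projectivization.exists_smul_eq_mk_rep ℂ v hv
  unfold VanAt
  rw [← hc, Units.smul_def, hom_eval_smul hG]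
  simp

theorem sep_lin {p q : P2} (h : p ≠ q) :
    ∃ a, eval q.rep (lin a) = 0 ∧ eval p.rep (lin a) ≠ 0 := by
  have hn : p.rep ∉ Submodule.span ℂ {q.rep} := by
    intro hm
    obtain ⟨c, hc⟩ := Submodule.mem_span_singleton.1 hm
    apply h
    rw [← p.mk_rep, ← q.mk_rep, Projectivization.mk_eq_mk_iff']
    exact ⟨c, hc⟩
  obtain ⟨f, hf1, hf2⟩ := Submodule.exists_le_ker_of_notMem hn
  have key : ∀ v, eval v (lin fun i => f (Pi.single i 1)) = f v := by
    intro v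
    rw [lin_eval]
    conv_rhs => rw [pi_eq_sum_univ' v]
    simp [map_sum, mul_comm]
  refine ⟨fun i => f (Pi.single i 1), ?_, ?_⟩
  · rw [key]
    exact hf2 (Submodule.mem_span_singleton_self _)
  · rw [key]; exact hf1

theorem exists_avoid (T : Finset P2) :
    ∃ a : Fin 3 → ℂ, a 2 ≠ 0 ∧ ∀ p ∈ T, eval p.rep (lin a) ≠ 0 := by
  have hne : (X 2 : MvPolynomial (Fin 3) ℂ) * ∏ p ∈ T, lin p.rep ≠ 0 := by
    apply mul_ne_zero (X_ne_zero _)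
    rw [Finset.prod_ne_zero_iff]
    intro p _ h0
    apply p.rep_nonzero
    ext i
    have := congrArg (eval (Pi.single i 1)) h0
    simpa [lin_eval, Pi.single_apply] using this
  obtain ⟨a, ha⟩ : ∃ a, eval a ((X 2 : MvPolynomial (Fin 3) ℂ) * ∏ p ∈ T, lin p.rep) ≠ 0 := by
    by_contra hc
    push Not at hc
    exact hne (MvPolynomial.funext (fun x => by simpa using hc x))
  rw [map_mul, map_prod] at ha
  refine ⟨a, ?_, ?_⟩
  · simpa using left_ne_zero_of_mul ha
  · intro p hp
    have := Finset.prod_ne_zero_iff.1 (right_ne_zero_of_mul ha) p hp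
    rw [lin_eval] at this ⊢
    simpa [mul_comm] using this

theorem sep_prod (T : Finset P2) (p : P2) (hp : p ∉ T) :
    ∃ K : MvPolynomial (Fin 3) ℂ, K.IsHomogeneous T.card ∧ (∀ q ∈ T, VanAt K q) ∧ ¬ VanAt K p := by
  have : ∀ q : P2, ∃ a, q ∈ T → eval q.rep (lin a) = 0 ∧ eval p.rep (lin a) ≠ 0 := by
    intro q
    by_cases h : q ∈ T
    · obtain ⟨a, ha⟩ := sep_lin (p := p) (q := q) (by rintro rfl; exact hp h)
      exact ⟨a, fun _ => ha⟩
    · exact ⟨0, fun h' => absurd h' h⟩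
  choose a ha using this
  refine ⟨∏ q ∈ T, lin (a q), ?_, ?_, ?_⟩
  · have := IsHomogeneous.prod T (fun q => lin (a q)) (fun _ => 1) (fun q _ => lin_hom _)
    simpa using this
  · intro q hq
    unfold VanAt
    rw [map_prod]
    exact Finset.prod_eq_zero hq (ha q hq).1
  · unfold VanAt
    rw [map_prod]
    exact Finset.prod_ne_zero_iff.2 fun q hq => (ha q hq).2

/-- evaluation of forms of degree `t` at a finite set of points -/
def ev (T : Finset P2) (t : ℕ) : homogeneousSubmodule (Fin 3) ℂ t →ₗ[ℂ] (T → ℂ) :=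
  LinearMap.pi fun p => (aeval (R := ℂ) p.1.rep).toLinearMap ∘ₗ (homogeneousSubmodule (Fin 3) ℂ t).subtype

theorem ev_apply (T : Finset P2) (t : ℕ) (f) (p : T) : ev T t f p = eval p.1.rep f.1 := rfl

theorem mem_ker_ev (T : Finset P2) (t : ℕ) (f) : f ∈ LinearMap.ker (ev T t) ↔ ∀ p ∈ T, VanAt f.1 p := by
  rw [LinearMap.mem_ker]
  constructor
  · intro h p hp
    exact congrFun h ⟨p, hp⟩
  · intro h
    ext p
    exact h p.1 p.2

theorem ev_surj (T : Finset P2) (t : ℕ) (ht : T.card ≤ t) : LinearMap.range (ev T t) = ⊤ := by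
  classical
  rw [eq_top_iff, ← (Pi.basisFun ℂ T).span_eq, Submodule.span_le]
  rintro _ ⟨p, rfl⟩
  obtain ⟨K, hK, h0, h1⟩ := sep_prod (T.erase p.1) p.1 (by simp)
  obtain ⟨a, _, ha⟩ := exists_avoid T
  have hcard : (T.erase p.1).card + 1 * (t - (T.erase p.1).card) = t := by
    have := Finset.card_le_card (Finset.erase_subset p.1 T)
    omega
  have hG : (K * lin a ^ (t - (T.erase p.1).card)).IsHomogeneous t := by
    have := hK.mul ((lin_hom a).pow (t - (T.erase p.1).card))
    rwa [hcard] at this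
  set G := K * lin a ^ (t - (T.erase p.1).card) with hGdef
  have hGp : eval p.1.rep G ≠ 0 := by
    rw [hGdef, map_mul, map_pow]
    exact mul_ne_zero h1 (pow_ne_zero _ (ha _ p.2))
  refine ⟨(eval p.1.rep G)⁻¹ • ⟨G, hG⟩, ?_⟩
  ext q
  rw [map_smul, Pi.smul_apply, ev_apply]
  by_cases hqp : q = p
  · subst hqp
    simp [hGp]
  · have : eval q.1.rep G = 0 := by
      have := h0 q.1 (Finset.mem_erase.2 ⟨fun h => hqp (Subtype.ext h), q.2⟩)
      unfold VanAt at this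
      rw [hGdef, map_mul, this, zero_mul]
    simp [this, hqp]

def mulW (G : MvPolynomial (Fin 3) ℂ) {m : ℕ} (hG : G.IsHomogeneous m) (s : ℕ) :
    homogeneousSubmodule (Fin 3) ℂ s →ₗ[ℂ] homogeneousSubmodule (Fin 3) ℂ (s + m) :=
  LinearMap.codRestrict _ ((LinearMap.mulRight ℂ G) ∘ₗ (homogeneousSubmodule (Fin 3) ℂ s).subtype)
    (fun f => IsHomogeneous.mul f.2 hG)

theorem mulW_coe (G : MvPolynomial (Fin 3) ℂ) {m : ℕ} (hG : G.IsHomogeneous m) (s : ℕ) (f) :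
    ((mulW G hG s f : _) : MvPolynomial (Fin 3) ℂ) = f.1 * G := rfl

/-- the data of a reduced complete intersection of type (m,m) -/
structure CI (F₁ F₂ : MvPolynomial (Fin 3) ℂ) (m : ℕ) (T : Finset P2) (a : Fin 3 → ℂ) : Prop where
  h1 : F₁.IsHomogeneous m
  h2 : F₂.IsHomogeneous m
  mem : ∀ p, p ∈ T ↔ VanAt F₁ p ∧ VanAt F₂ p
  card : T.card = m ^ 2
  m0 : 2 ≤ m
  a2 : a 2 ≠ 0
  av : ∀ p ∈ T, eval p.rep (lin a) ≠ 0

namespace CI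
variable {F₁ F₂ : MvPolynomial (Fin 3) ℂ} {m : ℕ} {T : Finset P2} {a : Fin 3 → ℂ}

theorem rp (h : CI F₁ F₂ m T a) : IsRelPrime (phi a F₁) (phi a F₂) := by
  intro π h1 h2
  apply rp_mod a h.a2 (Ideal.span {F₁, F₂})
  · intro v hv hl
    by_contra hv0
    have hp : Projectivization.mk ℂ v hv0 ∈ T := by
      rw [h.mem, van_mk h.h1, van_mk h.h2]
      exact ⟨hv _ (Ideal.subset_span (by simp)), hv _ (Ideal.subset_span (by simp))⟩
    have := h.av _ hp
    exact this ((van_mk (lin_hom a) v hv0).2 hl)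
  · intro f hf
    obtain ⟨x, y, rfl⟩ := Ideal.mem_span_pair.1 hf
    simp only [map_add, map_mul]
    exact dvd_add (h1.mul_left _) (h2.mul_left _)

theorem ne2 (h : CI F₁ F₂ m T a) : phi a F₂ ≠ 0 := by
  intro h0
  have h1 : IsUnit (phi a F₁) := h.rp dvd_rfl (by rw [h0]; exact dvd_zero _)
  have := h1.map (eval (0 : Fin 2 → ℂ))
  rw [hom_eval_zero (phi_hom a h.h1) (by have := h.m0; omega)] at this
  simp at this

theorem F2_ne (h : CI F₁ F₂ m T a) : F₂ ≠ 0 := by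
  intro h0; apply h.ne2; rw [h0, map_zero]

theorem noether_big (h : CI F₁ F₂ m T a) (f : MvPolynomial (Fin 3) ℂ) (s : ℕ) (hs : T.card ≤ s)
    (hf : f.IsHomogeneous (s + m + m)) (hv : ∀ p ∈ T, VanAt f p) : f ∈ Ideal.span {F₁, F₂} := by
  let Φ := (mulW F₁ h.h1 (s + m)).coprod (mulW F₂ h.h2 (s + m))
  let Ψ := (mulW F₂ h.h2 s).prod (-mulW F₁ h.h1 s)
  have hker : LinearMap.ker Φ ≤ LinearMap.range Ψ := by
    rintro ⟨x, y⟩ hxy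
    have e : x.1 * F₁ + y.1 * F₂ = 0 := by
      have := congrArg Subtype.val (LinearMap.mem_ker.1 hxy)
      simpa [Φ, mulW_coe] using this
    obtain ⟨w, hw⟩ := koszul a h.a2 h.rp h.ne2 h.h2 x.2 e
    have hs' : s + m - m = s := by omega
    have hwh : (tc w m (s + m)).IsHomogeneous s := by
      have := tc_hom w m (s + m)
      rwa [hs'] at this
    refine ⟨⟨_, hwh⟩, ?_⟩
    apply Prod.ext
    · apply Subtype.ext
      simp [Ψ, mulW_coe, ← hw]
    · apply Subtype.ext
      change -(tc w m (s + m) * F₁) = y.1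
      apply mul_right_cancel₀ h.F2_ne
      rw [hw] at e
      linear_combination -e
  have hk : Module.finrank ℂ (LinearMap.ker Φ) ≤ (s + 2).choose 2 := by
    refine (Submodule.finrank_mono hker).trans ?_
    refine (LinearMap.finrank_range_le Ψ).trans ?_
    rw [finrank_hom]
  have hrn := LinearMap.finrank_range_add_finrank_ker Φ
  rw [Module.finrank_prod, finrank_hom] at hrn
  have hev := LinearMap.finrank_range_add_finrank_ker (ev T (s + m + m))
  rw [ev_surj T (s + m + m) (by omega), finrank_top, finrank_hom] at hev
  simp only [Module.finrank_fintype_fun_eq_card, Fintype.card_coe, h.card] at hev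
  have hle : LinearMap.range Φ ≤ LinearMap.ker (ev T (s + m + m)) := by
    rintro _ ⟨⟨x, y⟩, rfl⟩
    rw [mem_ker_ev]
    intro p hp
    obtain ⟨e1, e2⟩ := (h.mem p).1 hp
    unfold VanAt at *
    simp [Φ, mulW_coe, e1, e2]
  have heq : LinearMap.range Φ = LinearMap.ker (ev T (s + m + m)) := by
    apply Submodule.eq_of_le_of_finrank_le hle
    have c1 := choose_two_aux s
    have c2 := choose_two_aux (s + m)
    have c3 := choose_two_aux (s + m + m)
    nlinarith
  have hfm : (⟨f, hf⟩ : homogeneousSubmodule (Fin 3) ℂ (s + m + m)) ∈ LinearMap.range Φ := by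
    rw [heq, mem_ker_ev]
    exact hv
  obtain ⟨⟨x, y⟩, hxy⟩ := hfm
  rw [Ideal.mem_span_pair]
  refine ⟨x.1, y.1, ?_⟩
  have := congrArg Subtype.val hxy
  simpa [Φ, mulW_coe] using this

theorem noether (h : CI F₁ F₂ m T a) {f : MvPolynomial (Fin 3) ℂ} {t : ℕ}
    (hf : f.IsHomogeneous t) (hv : ∀ p ∈ T, VanAt f p) : f ∈ Ideal.span {F₁, F₂} := by
  apply nzd a h.a2 h.rp h.ne2 (T.card + m + m)
  apply h.noether_big _ (T.card + t) (by omega)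
  · have := ((lin_hom a).pow (T.card + m + m)).mul hf
    rwa [show 1 * (T.card + m + m) + t = T.card + t + m + m by ring] at this
  · intro p hp
    have := hv p hp
    unfold VanAt at *
    rw [map_mul, this, mul_zero]

theorem noether_small (h : CI F₁ F₂ m T a) {f : MvPolynomial (Fin 3) ℂ} {t : ℕ} (ht : t < m)
    (hf : f.IsHomogeneous t) (hv : ∀ p ∈ T, VanAt f p) : f = 0 := by
  obtain ⟨x, y, hxy⟩ := Ideal.mem_span_pair.1 (h.noether hf hv)
  have := hom_decomp hf h.h1 h.h2 hxy.symm
  rw [tc_lt _ _ _ ht, tc_lt _ _ _ ht] at this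
  simpa using this

end CI

namespace CI
variable {F₁ F₂ : MvPolynomial (Fin 3) ℂ} {m : ℕ} {T : Finset P2} {a : Fin 3 → ℂ}

theorem dvd_aux {x0 x1 : MvPolynomial (Fin 2) ℂ} (h : X 1 * x0 - X 0 * x1 = 0) :
    X 0 ∣ x0 := by
  apply relprime_X.dvd_of_dvd_mul_left
  exact ⟨x1, by linear_combination h⟩

/-- Socle computation. -/
theorem socle (h : CI F₁ F₂ m T a) {t : ℕ} (ht : t + 3 ≤ 2 * m) {g : MvPolynomial (Fin 2) ℂ}
    (hg : g.IsHomogeneous t) (hx : ∀ i, ∃ x y, X i * g = x * phi a F₁ + y * phi a F₂) :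
    ∃ x y, g = x * phi a F₁ + y * phi a F₂ := by
  have hm := h.m0
  have h1 := phi_hom a h.h1
  have h2 := phi_hom a h.h2
  have hx' : ∀ i, ∃ x y : MvPolynomial (Fin 2) ℂ, x.IsHomogeneous (1 + t - m) ∧
      X i * g = x * phi a F₁ + y * phi a F₂ := by
    intro i
    obtain ⟨x, y, e⟩ := hx i
    exact ⟨tc x m (1 + t), tc y m (1 + t), tc_hom _ _ _,
      hom_decomp ((isHomogeneous_X _ _).mul hg) h1 h2 e⟩
  obtain ⟨x0, y0, hx0, e0⟩ := hx' 0
  obtain ⟨x1, y1, hx1, e1⟩ := hx' 1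
  have hz : (X 1 * x0 - X 0 * x1) * phi a F₁ + (X 1 * y0 - X 0 * y1) * phi a F₂ = 0 := by
    linear_combination X 0 * e1 - X 1 * e0
  have hxz : X 1 * x0 - X 0 * x1 = 0 := by
    refine dvd_hom_lt (n := 1 + (1 + t - m)) h2 ?_ (by omega) ?_
    · exact ((isHomogeneous_X _ _).mul hx0).sub ((isHomogeneous_X _ _).mul hx1)
    · apply h.rp.symm.dvd_of_dvd_mul_right
      exact ⟨-(X 1 * y0 - X 0 * y1), by linear_combination hz⟩
  have hyz : X 1 * y0 - X 0 * y1 = 0 := by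
    rw [hxz, zero_mul, zero_add] at hz
    exact (mul_eq_zero.1 hz).resolve_right h.ne2
  obtain ⟨x, hx⟩ := dvd_aux hxz
  obtain ⟨y, hy⟩ := dvd_aux hyz
  refine ⟨x, y, ?_⟩
  apply mul_left_cancel₀ (X_ne_zero (R := ℂ) (0 : Fin 2))
  rw [hx, hy] at e0
  linear_combination e0

theorem cb_step (h : CI F₁ F₂ m T a) (q : P2) (hq : q ∈ T) (t : ℕ) (ht : t + 3 ≤ 2 * m)
    (f : MvPolynomial (Fin 3) ℂ) (hf : f.IsHomogeneous t) (hv : ∀ p ∈ T, p ≠ q → VanAt f p) :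
    ∃ f', ∀ p ∈ T, eval p.rep f = eval p.rep (tc f' 1 t) * eval p.rep (lin a) := by
  obtain ⟨x, y, e⟩ := h.socle ht (phi_hom a hf) (by
    intro i
    have hlq := h.av q hq
    let c : ℂ := q.rep (i.castSucc) / eval q.rep (lin a)
    have hl1 : (X i.castSucc - C c * lin a).IsHomogeneous 1 :=
      (isHomogeneous_X _ _).sub ((lin_hom a).C_mul c)
    have hmem : (X i.castSucc - C c * lin a) * f ∈ Ideal.span {F₁, F₂} := by
      apply h.noether (hl1.mul hf)
      intro p hp
      unfold VanAt
      by_cases hpq : p = q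
      · subst hpq
        simp [c, hlq]
      · have := hv p hp hpq
        unfold VanAt at this
        simp [this]
    obtain ⟨x, y, hxy⟩ := Ideal.mem_span_pair.1 hmem
    refine ⟨phi a x, phi a y, ?_⟩
    rw [← map_mul, ← map_mul, ← map_add, hxy]
    simp only [map_sub, map_mul, phi_lin a h.a2, mul_zero, sub_zero]
    congr 1
    fin_cases i <;> simp [phi])
  obtain ⟨f', hf'⟩ := phi_ker a h.a2 (f := f - psi x * F₁ - psi y * F₂) (by
    simp only [map_sub, map_mul, phi_psi, e]; ring)
  have e2 : f = psi x * F₁ + psi y * F₂ + f' * lin a := by linear_combination hf'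
  have e3 := congrArg (homogeneousComponent t) e2
  rw [homogeneousComponent_eq_self hf, map_add, map_add, comp_mul_tc _ _ _ _ h.h1,
    comp_mul_tc _ _ _ _ h.h2, comp_mul_tc _ _ _ _ (lin_hom a)] at e3
  refine ⟨f', ?_⟩
  intro p hp
  obtain ⟨k1, k2⟩ := (h.mem p).1 hp
  unfold VanAt at k1 k2
  rw [e3]
  simp [k1, k2]

theorem cb (h : CI F₁ F₂ m T a) (q : P2) (hq : q ∈ T) (t : ℕ) : t + 3 ≤ 2 * m →
    ∀ f : MvPolynomial (Fin 3) ℂ, f.IsHomogeneous t → (∀ p ∈ T, p ≠ q → VanAt f p) → VanAt f q := by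
  induction t with
  | zero =>
    intro ht f hf hv
    obtain ⟨f', hT⟩ := h.cb_step q hq 0 ht f hf hv
    have := hT q hq
    rw [tc_lt _ _ _ (by omega)] at this
    simpa [VanAt] using this
  | succ t ih =>
    intro ht f hf hv
    obtain ⟨f', hT⟩ := h.cb_step q hq (t + 1) ht f hf hv
    have hh := ih (by omega) (tc f' 1 (t + 1)) (tc_hom f' 1 (t + 1)) (by
      intro p hp hpq
      have h1 := hv p hp hpq
      unfold VanAt at h1 ⊢
      rw [hT p hp] at h1
      exact (mul_eq_zero.1 h1).resolve_right (h.av p hp))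
    unfold VanAt at hh ⊢
    rw [hT q hq, hh, zero_mul]

end CI

theorem min_subset (S : Finset P2) (k : ℕ)
    (hS : ∀ g : MvPolynomial (Fin 3) ℂ, g.IsHomogeneous k → (∀ p ∈ S, VanAt g p) → g = 0) :
    ∃ Y ⊆ S, Y.card = (k + 2).choose 2 ∧
      (∀ g : MvPolynomial (Fin 3) ℂ, g.IsHomogeneous k → (∀ p ∈ Y, VanAt g p) → g = 0) ∧
      (∀ p ∈ Y, ∃ g : MvPolynomial (Fin 3) ℂ, g.IsHomogeneous k ∧
        (∀ q ∈ Y, q ≠ p → VanAt g q) ∧ ¬ VanAt g p) := by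
  classical
  let P : Finset P2 → Prop := fun Y => Y ⊆ S ∧
    ∀ g : MvPolynomial (Fin 3) ℂ, g.IsHomogeneous k → (∀ p ∈ Y, VanAt g p) → g = 0
  obtain ⟨Y, hY⟩ := exists_minimal_of_wellFoundedLT P ⟨S, subset_rfl, hS⟩
  have hsep : ∀ p ∈ Y, ∃ g : MvPolynomial (Fin 3) ℂ, g.IsHomogeneous k ∧
        (∀ q ∈ Y, q ≠ p → VanAt g q) ∧ ¬ VanAt g p := by
    intro p hp
    have : ¬ P (Y.erase p) := by
      intro hP
      have := hY.le_of_le hP (Finset.erase_subset _ _)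
      exact absurd (this hp) (by simp)
    simp only [P, not_and, not_forall] at this
    obtain ⟨g, hg, hv, h0⟩ := this ((Finset.erase_subset _ _).trans hY.prop.1)
    refine ⟨g, hg, fun q hq hqp => hv q (Finset.mem_erase.2 ⟨hqp, hq⟩), ?_⟩
    intro hvp
    apply h0
    apply hY.prop.2 g hg
    intro q hq
    by_cases hqp : q = p
    · rw [hqp]; exact hvp
    · exact hv q (Finset.mem_erase.2 ⟨hqp, hq⟩)
  refine ⟨Y, hY.prop.1, ?_, hY.prop.2, hsep⟩
  have hinj : LinearMap.ker (ev Y k) = ⊥ := by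
    rw [eq_bot_iff]
    intro g hg
    rw [mem_ker_ev] at hg
    exact Subtype.ext (hY.prop.2 g.1 g.2 hg)
  have hsur : LinearMap.range (ev Y k) = ⊤ := by
    rw [eq_top_iff, ← (Pi.basisFun ℂ Y).span_eq, Submodule.span_le]
    rintro _ ⟨p, rfl⟩
    obtain ⟨G, hG, h0, hGp⟩ := hsep p.1 p.2
    unfold VanAt at hGp h0
    refine ⟨(eval p.1.rep G)⁻¹ • ⟨G, hG⟩, ?_⟩
    ext q
    rw [map_smul, Pi.smul_apply, ev_apply]
    by_cases hqp : q = p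
    · subst hqp
      simp [hGp]
    · have : eval q.1.rep G = 0 := h0 q.1 q.2 (fun h => hqp (Subtype.ext h))
      simp [this, hqp]
  have := LinearMap.finrank_range_add_finrank_ker (ev Y k)
  rw [hinj, hsur, finrank_top, finrank_bot, finrank_hom] at this
  simpa using this

/-- the Jacobian ideal -/
def Jac (F : MvPolynomial (Fin 3) ℂ) : Ideal (MvPolynomial (Fin 3) ℂ) :=
  Ideal.span (Set.range fun i => pderiv i F)

theorem singPt_F {d : ℕ} (hd : 3 ≤ d) {F : MvPolynomial (Fin 3) ℂ} (hF : F.IsHomogeneous d)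
    {p : P2} (hp : SingPt F p) : eval p.rep F = 0 := by
  have := congrArg (eval p.rep) hF.sum_X_mul_pderiv
  rw [map_sum] at this
  simp only [map_mul, hp _, mul_zero, Finset.sum_const_zero, map_nsmul] at this
  have h2 := this.symm
  rw [nsmul_eq_mul] at h2
  refine (mul_eq_zero.1 h2).resolve_left ?_
  exact_mod_cast (by omega : d ≠ 0)

theorem jac_zero {d : ℕ} {F : MvPolynomial (Fin 3) ℂ} (hF : F.IsHomogeneous d)
    (v : Fin 3 → ℂ) (hv : v ≠ 0) (h : ∀ f ∈ Jac F, eval v f = 0) :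
    SingPt F (Projectivization.mk ℂ v hv) := by
  intro i
  exact (van_mk (hF.pderiv (i := i)) v hv).2 (h _ (Ideal.subset_span ⟨i, rfl⟩))

theorem phi_F_ne {d : ℕ} (hd : 3 ≤ d) {F : MvPolynomial (Fin 3) ℂ}
    (hF : F.IsHomogeneous d) (hirr : Irreducible F) (a : Fin 3 → ℂ) (h2 : a 2 ≠ 0) :
    phi a F ≠ 0 := by
  intro h0
  have hdv := phi_ker a h2 h0
  have hnu : ¬ IsUnit (lin a) := by
    intro hu
    have := hu.map (eval (0 : Fin 3 → ℂ))
    rw [hom_eval_zero (lin_hom a) one_ne_zero] at this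
    simp at this
  have := (hirr.dvd_iff.1 hdv).resolve_left hnu
  exact lin_ne a h2 (dvd_hom_lt hF (lin_hom a) (by omega) this.dvd)

theorem exists_H {d : ℕ} (hd : 3 ≤ d) {F : MvPolynomial (Fin 3) ℂ}
    (hF : F.IsHomogeneous d) (hirr : Irreducible F) (a : Fin 3 → ℂ) (h2 : a 2 ≠ 0)
    (hav : ∀ p, SingPt F p → eval p.rep (lin a) ≠ 0) :
    ∃ c : Fin 3 → ℂ, IsRelPrime (phi a F) (phi a (∑ i, C (c i) * pderiv i F)) := by
  classical
  have hF0 := phi_F_ne hd hF hirr a h2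
  let L : (Fin 3 → ℂ) →ₗ[ℂ] MvPolynomial (Fin 2) ℂ :=
    Fintype.linearCombination ℂ (fun i => phi a (pderiv i F))
  have hL : ∀ c : Fin 3 → ℂ, phi a (∑ i, C (c i) * pderiv i F) = L c := by
    intro c
    simp [L, Fintype.linearCombination_apply, map_sum, smul_eq_C_mul]
  let E : MvPolynomial (Fin 2) ℂ → Submodule ℂ (Fin 3 → ℂ) := fun π =>
    ((Ideal.span {π}).restrictScalars ℂ).comap L
  have hE : ∀ π c, c ∈ E π ↔ π ∣ L c := by
    intro π c
    simp [E, Ideal.mem_span_singleton]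
  let fs := (UniqueFactorizationMonoid.factors (phi a F)).toFinset
  have hne : (⊤ : Submodule ℂ (Fin 3 → ℂ)) ∉ fs.image E := by
    intro hm
    obtain ⟨π, hπ, htop⟩ := Finset.mem_image.1 hm
    have hirrπ : Irreducible π :=
      UniqueFactorizationMonoid.irreducible_of_factor π (Multiset.mem_toFinset.1 hπ)
    apply hirrπ.not_isUnit
    apply rp_mod a h2 (Jac F)
    · intro v hv hl
      by_contra hv0
      exact hav _ (jac_zero hF v hv0 hv) ((van_mk (lin_hom a) v hv0).2 hl)
    · intro f hf
      obtain ⟨b, rfl⟩ := (Ideal.mem_span_range_iff_exists_fun).1 hf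
      rw [map_sum]
      apply Finset.dvd_sum
      intro i _
      rw [map_mul]
      apply Dvd.dvd.mul_left
      have hmem : (Pi.single i 1 : Fin 3 → ℂ) ∈ E π := by rw [htop]; trivial
      rw [hE] at hmem
      simpa [L, Fintype.linearCombination_apply, Pi.single_apply] using hmem
  have hu := Subspace.biUnion_ne_univ_of_top_notMem hne
  obtain ⟨c, hc⟩ := (Set.ne_univ_iff_exists_notMem _).1 hu
  refine ⟨c, ?_⟩
  rw [hL]
  refine WfDvdMonoid.isRelPrime_of_no_irreducible_factors (fun h => hF0 h.1) ?_
  intro z hz hz1 hz2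
  obtain ⟨π, hπ, hass⟩ := UniqueFactorizationMonoid.exists_mem_factors_of_dvd hF0 hz hz1
  apply hc
  simp only [Set.mem_iUnion]
  refine ⟨E π, Finset.mem_image.2 ⟨π, Multiset.mem_toFinset.2 hπ, rfl⟩, ?_⟩
  rw [SetLike.mem_coe, hE]
  exact hass.symm.dvd.trans hz2

/-- the cross product with the Euler field -/
def uvec (θ : Fin 3 → MvPolynomial (Fin 3) ℂ) : Fin 3 → MvPolynomial (Fin 3) ℂ :=
  ![θ 1 * X 2 - θ 2 * X 1, θ 2 * X 0 - θ 0 * X 2, θ 0 * X 1 - θ 1 * X 0]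

theorem uvec_hom {θ : Fin 3 → MvPolynomial (Fin 3) ℂ} {k : ℕ} (h : ∀ i, (θ i).IsHomogeneous k) (i) :
    (uvec θ i).IsHomogeneous (k + 1) := by
  have : ∀ i j, (θ i * X j).IsHomogeneous (k + 1) := fun i j => (h i).mul (isHomogeneous_X _ _)
  fin_cases i <;> exact (this _ _).sub (this _ _)

theorem uvec_cross {d : ℕ} {F : MvPolynomial (Fin 3) ℂ} (hF : F.IsHomogeneous d)
    {θ : Fin 3 → MvPolynomial (Fin 3) ℂ} (hs : ∑ i, θ i * pderiv i F = 0) :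
    uvec θ 1 * pderiv 2 F - uvec θ 2 * pderiv 1 F = -(d : MvPolynomial (Fin 3) ℂ) * F * θ 0 ∧
    uvec θ 2 * pderiv 0 F - uvec θ 0 * pderiv 2 F = -(d : MvPolynomial (Fin 3) ℂ) * F * θ 1 ∧
    uvec θ 0 * pderiv 1 F - uvec θ 1 * pderiv 0 F = -(d : MvPolynomial (Fin 3) ℂ) * F * θ 2 := by
  have he := hF.sum_X_mul_pderiv
  rw [nsmul_eq_mul] at he
  simp only [Fin.sum_univ_three] at he hs
  simp only [uvec, Matrix.cons_val]
  refine ⟨?_, ?_, ?_⟩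
  · linear_combination X 0 * hs - θ 0 * he
  · linear_combination X 1 * hs - θ 1 * he
  · linear_combination X 2 * hs - θ 2 * he

theorem uvec_dvd {d : ℕ} {F : MvPolynomial (Fin 3) ℂ} (hF : F.IsHomogeneous d)
    {θ : Fin 3 → MvPolynomial (Fin 3) ℂ} (hs : ∑ i, θ i * pderiv i F = 0) (i j : Fin 3) :
    F ∣ uvec θ i * pderiv j F - uvec θ j * pderiv i F := by
  obtain ⟨h0, h1, h2⟩ := uvec_cross hF hs
  have d0 : F ∣ uvec θ 1 * pderiv 2 F - uvec θ 2 * pderiv 1 F :=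
    ⟨-(d : MvPolynomial (Fin 3) ℂ) * θ 0, by linear_combination h0⟩
  have d1 : F ∣ uvec θ 2 * pderiv 0 F - uvec θ 0 * pderiv 2 F :=
    ⟨-(d : MvPolynomial (Fin 3) ℂ) * θ 1, by linear_combination h1⟩
  have d2 : F ∣ uvec θ 0 * pderiv 1 F - uvec θ 1 * pderiv 0 F :=
    ⟨-(d : MvPolynomial (Fin 3) ℂ) * θ 2, by linear_combination h2⟩
  fin_cases i <;> fin_cases j
  · simp
  · exact d2
  · exact (dvd_sub_comm).1 d1
  · exact (dvd_sub_comm).1 d2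
  · simp
  · exact d0
  · exact d1
  · exact (dvd_sub_comm).1 d0
  · simp

theorem uvec_node {d : ℕ} {F : MvPolynomial (Fin 3) ℂ} (hF : F.IsHomogeneous d)
    {θ : Fin 3 → MvPolynomial (Fin 3) ℂ} (hs : ∑ i, θ i * pderiv i F = 0) {p : P2}
    (hp : IsNode F p) (i : Fin 3) : eval p.rep (uvec θ i) = 0 := by
  obtain ⟨hsing, hrank⟩ := hp
  set M := (Matrix.of fun i j : Fin 3 => eval p.rep (pderiv i (pderiv j F))) with hM
  have k1 : M.mulVecLin (fun j => eval p.rep (θ j)) = 0 := by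
    ext i
    have := congrArg (fun g => eval p.rep (pderiv i g)) hs
    simp only [map_sum, Derivation.leibniz, smul_eq_mul, map_add, map_mul, hsing _, map_zero,
      zero_mul, add_zero] at this
    simpa [Matrix.mulVec, dotProduct, hM, mul_comm] using this
  have k2 : M.mulVecLin p.rep = 0 := by
    ext i
    have := congrArg (fun g => eval p.rep (pderiv i g)) hF.sum_X_mul_pderiv
    simp only [map_sum, Derivation.leibniz, smul_eq_mul, map_add, map_mul, hsing _, map_nsmul,
      zero_mul, add_zero, eval_X, smul_zero] at this
    simpa [Matrix.mulVec, dotProduct, hM, mul_comm] using this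
  have hrn := LinearMap.finrank_range_add_finrank_ker M.mulVecLin
  have hr : Module.finrank ℂ (LinearMap.range M.mulVecLin) = 2 := hrank
  rw [hr] at hrn
  have hk : Module.finrank ℂ (LinearMap.ker M.mulVecLin) = 1 := by
    simp at hrn; omega
  have hne : (⟨p.rep, k2⟩ : LinearMap.ker M.mulVecLin) ≠ 0 := by
    intro h
    exact p.rep_nonzero (congrArg Subtype.val h)
  obtain ⟨c, hc⟩ := (finrank_eq_one_iff_of_nonzero' _ hne).1 hk ⟨_, k1⟩
  have hc' : ∀ j, eval p.rep (θ j) = c * p.rep j := by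
    intro j
    have := congrFun (congrArg Subtype.val hc) j
    simpa using this.symm
  fin_cases i <;> simp [uvec, hc'] <;> ring

theorem no_syz {d : ℕ} (hd : 3 ≤ d) {F : MvPolynomial (Fin 3) ℂ}
    (hF : F.IsHomogeneous d) (hirr : Irreducible F) (hnodal : Nodal F)
    (a : Fin 3 → ℂ) (h2 : a 2 ≠ 0)
    (hav : ∀ p, SingPt F p → eval p.rep (lin a) ≠ 0)
    (hcol : ∀ (t : ℕ) (Q : MvPolynomial (Fin 3) ℂ), Q.IsHomogeneous t →
      (∀ p, SingPt F p → VanAt Q p) → ∃ N : ℕ, lin a ^ N * Q ∈ Jac F)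
    (θ : Fin 3 → MvPolynomial (Fin 3) ℂ) (hθ : ∀ i, (θ i).IsHomogeneous (d - 3))
    (hs : ∑ i, θ i * pderiv i F = 0) : θ = 0 := by
  obtain ⟨c, hrp⟩ := exists_H hd hF hirr a h2 hav
  set H := ∑ i, C (c i) * pderiv i F with hHdef
  have hHh : H.IsHomogeneous (d - 1) :=
    IsHomogeneous.sum _ _ _ fun i _ => (hF.pderiv).C_mul _
  have hH : phi a H ≠ 0 := by
    intro h0
    have h1 : IsUnit (phi a F) := hrp dvd_rfl (by rw [h0]; exact dvd_zero _)
    have := h1.map (eval (0 : Fin 2 → ℂ))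
    rw [hom_eval_zero (phi_hom a hF) (by omega)] at this
    simp at this
  have hH0 : H ≠ 0 := by intro h0; apply hH; rw [h0, map_zero]
  have hFH : ¬ F ∣ H := fun h => hH0 (dvd_hom_lt hF hHh (by omega) h)
  have hprime : Prime F := hirr.prime
  have hu : ∀ i, (uvec θ i).IsHomogeneous (d - 2) := by
    intro i
    have := uvec_hom hθ i
    rwa [show d - 3 + 1 = d - 2 by omega] at this
  set U := ∑ i, C (c i) * uvec θ i with hUdef
  have hUh : U.IsHomogeneous (d - 2) :=
    IsHomogeneous.sum _ _ _ fun i _ => (hu i).C_mul _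
  have hUj : ∀ j, F ∣ U * pderiv j F - uvec θ j * H := by
    intro j
    have : U * pderiv j F - uvec θ j * H =
        ∑ i, C (c i) * (uvec θ i * pderiv j F - uvec θ j * pderiv i F) := by
      rw [hUdef, hHdef, Finset.sum_mul, Finset.mul_sum, ← Finset.sum_sub_distrib]
      apply Finset.sum_congr rfl
      intro i _
      ring
    rw [this]
    exact Finset.dvd_sum fun i _ => (uvec_dvd hF hs i j).mul_left _
  -- the descent step
  have step : ∀ (t : ℕ) (Q : MvPolynomial (Fin 3) ℂ), Q.IsHomogeneous t →
      (∀ p, SingPt F p → VanAt Q p) →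
      ∃ Q' v, Q * U = tc Q' (d - 1) (t + (d - 2)) * H + v * F ∧
        (∀ p, SingPt F p → VanAt (tc Q' (d - 1) (t + (d - 2))) p) := by
    intro t Q hQ hv
    obtain ⟨N, hN⟩ := hcol t Q hQ hv
    obtain ⟨b, hb⟩ := (Ideal.mem_span_range_iff_exists_fun).1 hN
    have hdiv : F ∣ lin a ^ N * (Q * U) - (∑ i, b i * uvec θ i) * H := by
      have : lin a ^ N * (Q * U) - (∑ i, b i * uvec θ i) * H =
          ∑ i, b i * (U * pderiv i F - uvec θ i * H) := by
        rw [← mul_assoc, ← hb, Finset.sum_mul, Finset.sum_mul, ← Finset.sum_sub_distrib]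
        apply Finset.sum_congr rfl
        intro i _
        ring
      rw [this]
      exact Finset.dvd_sum fun i _ => (hUj i).mul_left _
    obtain ⟨w, hw⟩ := hdiv
    have hmem : Q * U ∈ Ideal.span {F, H} := by
      apply nzd a h2 hrp hH N
      rw [Ideal.mem_span_pair]
      exact ⟨w, ∑ i, b i * uvec θ i, by linear_combination -hw⟩
    obtain ⟨x, y, hxy⟩ := Ideal.mem_span_pair.1 hmem
    have hdec := hom_decomp (a := y) (b := x) (hQ.mul hUh) hHh hF (by rw [← hxy]; ring)
    refine ⟨y, _, hdec, ?_⟩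
    set Q' := tc y (d - 1) (t + (d - 2)) with hQ'
    have hdv : F ∣ (lin a ^ N * Q' - ∑ i, b i * uvec θ i) * H := by
      refine ⟨w - lin a ^ N * tc x d (t + (d - 2)), ?_⟩
      rw [hdec] at hw
      linear_combination hw
    obtain ⟨z, hz⟩ := (hprime.dvd_or_dvd hdv).resolve_right hFH
    intro p hp
    have hev := congrArg (eval p.rep) hz
    simp only [map_sub, map_mul, map_pow, map_sum, uvec_node hF hs (hnodal p hp), mul_zero,
      Finset.sum_const_zero, sub_zero, singPt_F hd hF hp, zero_mul] at hev
    exact (mul_eq_zero.1 hev).resolve_left (pow_ne_zero _ (hav p hp))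
  have hUF : F ∣ U → U = 0 := fun h => dvd_hom_lt hF hUh (by omega) h
  have desc : ∀ (t : ℕ) (Q : MvPolynomial (Fin 3) ℂ), Q.IsHomogeneous t →
      (∀ p, SingPt F p → VanAt Q p) → ¬ F ∣ Q → U = 0 := by
    intro t
    induction t with
    | zero =>
      intro Q hQ hv hFQ
      obtain ⟨Q', v, e, _⟩ := step 0 Q hQ hv
      rw [tc_lt _ _ _ (by omega), zero_mul, zero_add] at e
      apply hUF
      exact (hprime.dvd_or_dvd ⟨v, by rw [e]; ring⟩).resolve_left hFQ
    | succ t ih =>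
      intro Q hQ hv hFQ
      obtain ⟨Q', v, e, hv'⟩ := step (t + 1) Q hQ hv
      by_cases hd' : F ∣ tc Q' (d - 1) (t + 1 + (d - 2))
      · apply hUF
        refine (hprime.dvd_or_dvd ?_).resolve_left hFQ
        rw [e]
        exact dvd_add (hd'.mul_right _) (dvd_mul_left _ _)
      · refine ih _ ?_ hv' hd'
        have := tc_hom Q' (d - 1) (t + 1 + (d - 2))
        rwa [show t + 1 + (d - 2) - (d - 1) = t by omega] at this
  have hU0 : U = 0 := by
    refine desc (d - 1) H hHh ?_ hFH
    intro p hp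
    unfold VanAt
    rw [hHdef, map_sum]
    apply Finset.sum_eq_zero
    intro i _
    rw [map_mul, hp i, mul_zero]
  have hu0 : ∀ j, uvec θ j = 0 := by
    intro j
    have := hUj j
    rw [hU0, zero_mul, zero_sub, dvd_neg] at this
    exact dvd_hom_lt hF (hu j) (by omega) ((hprime.dvd_or_dvd this).resolve_right hFH)
  obtain ⟨e0, e1, e2⟩ := uvec_cross hF hs
  simp only [hu0, zero_mul, sub_zero] at e0 e1 e2
  have hdF : -(d : MvPolynomial (Fin 3) ℂ) * F ≠ 0 :=
    mul_ne_zero (neg_ne_zero.2 (by exact_mod_cast (by omega : d ≠ 0))) hirr.ne_zero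
  ext1 i
  fin_cases i
  · exact (mul_eq_zero.1 e0.symm).resolve_left hdF
  · exact (mul_eq_zero.1 e1.symm).resolve_left hdF
  · exact (mul_eq_zero.1 e2.symm).resolve_left hdF

theorem span_form {F G : MvPolynomial (Fin 3) ℂ}
    (h : G ∈ Submodule.span ℂ {pderiv 0 F, pderiv 1 F, pderiv 2 F}) :
    ∃ α : Fin 3 → ℂ, G = ∑ i, C (α i) * pderiv i F := by
  obtain ⟨a, b, c, h⟩ := Submodule.mem_span_triple.1 h
  refine ⟨![a, b, c], ?_⟩
  rw [← h, Fin.sum_univ_three]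
  simp [smul_eq_C_mul]

theorem form_hom {d : ℕ} {F : MvPolynomial (Fin 3) ℂ} (hF : F.IsHomogeneous d) (α : Fin 3 → ℂ) :
    (∑ i, C (α i) * pderiv i F).IsHomogeneous (d - 1) := by
  refine IsHomogeneous.sum _ _ _ fun i _ => ?_
  exact (hF.pderiv (i := i)).C_mul _

theorem form_jac (F : MvPolynomial (Fin 3) ℂ) (α : Fin 3 → ℂ) :
    (∑ i, C (α i) * pderiv i F) ∈ Jac F :=
  Ideal.sum_mem _ fun i _ => Ideal.mul_mem_left _ _ (Ideal.subset_span ⟨i, rfl⟩)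

theorem exists_perp (α β : Fin 3 → ℂ) :
    ∃ γ : Fin 3 → ℂ, γ ≠ 0 ∧ ∑ i, γ i * α i = 0 ∧ ∑ i, γ i * β i = 0 := by
  let M : Matrix (Fin 2) (Fin 3) ℂ := Matrix.of ![α, β]
  have : LinearMap.ker M.mulVecLin ≠ ⊥ := by
    apply LinearMap.ker_ne_bot_of_finrank_lt
    simp
  obtain ⟨γ, hγ, h0⟩ := Submodule.exists_mem_ne_zero_of_ne_bot this
  refine ⟨γ, h0, ?_, ?_⟩
  · have := congrFun (LinearMap.mem_ker.1 hγ) 0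
    simpa [M, Matrix.mulVec, dotProduct, mul_comm] using this
  · have := congrFun (LinearMap.mem_ker.1 hγ) 1
    simpa [M, Matrix.mulVec, dotProduct, mul_comm] using this

theorem colon_pow {d : ℕ} {F : MvPolynomial (Fin 3) ℂ} (hF : F.IsHomogeneous d)
    {F₁ F₂ : MvPolynomial (Fin 3) ℂ} {m : ℕ} {T : Finset P2} {a : Fin 3 → ℂ}
    (h : CI F₁ F₂ m T a) (hle : Ideal.span {F₁, F₂} ≤ Jac F) (Sf : Finset P2)
    (hS : ∀ p ∈ Sf, ¬ SingPt F p) (hT : ∀ p ∈ T, p ∈ Sf ∨ SingPt F p)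
    (t : ℕ) (Q : MvPolynomial (Fin 3) ℂ) (hQ : Q.IsHomogeneous t)
    (hv : ∀ p, SingPt F p → VanAt Q p) : ∃ N, lin a ^ N * Q ∈ Jac F := by
  let I : Ideal (MvPolynomial (Fin 3) ℂ) :=
    Submodule.comap (LinearMap.mulRight (MvPolynomial (Fin 3) ℂ) Q) (Jac F)
  have hI : ∀ K, K ∈ I ↔ K * Q ∈ Jac F := fun K => Iff.rfl
  obtain ⟨N, hN⟩ := nullst I (lin a) (by
    intro v hvI
    by_cases hv0 : v = 0
    · rw [lin_eval, hv0]; simp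
    exfalso
    have hs : SingPt F (Projectivization.mk ℂ v hv0) := by
      apply jac_zero hF v hv0
      intro f hf
      exact hvI f ((hI f).2 (Ideal.mul_mem_right _ _ hf))
    obtain ⟨K, hK, hK1, hK2⟩ := sep_prod Sf _ (fun hm => hS _ hm hs)
    apply hK2
    rw [van_mk hK]
    apply hvI
    rw [hI]
    apply hle
    refine h.noether (hK.mul hQ) ?_
    intro p hp
    rcases hT p hp with h1 | h1
    · have := hK1 p h1
      simp only [VanAt] at this ⊢
      simp [this]
    · have := hv p h1
      simp only [VanAt] at this ⊢
      simp [this])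
  exact ⟨N, hN⟩

theorem alpha_claim {d : ℕ} (hd : 3 ≤ d) {F : MvPolynomial (Fin 3) ℂ} (hF : F.IsHomogeneous d)
    {α β : Fin 3 → ℂ} {T : Finset P2} {a : Fin 3 → ℂ}
    (h : CI (∑ i, C (α i) * pderiv i F) (∑ i, C (β i) * pderiv i F) (d - 1) T a)
    (Sf : Finset P2) (hT : ∀ p ∈ T, p ∈ Sf ∨ SingPt F p)
    (hsyz : ∀ θ : Fin 3 → MvPolynomial (Fin 3) ℂ, (∀ i, (θ i).IsHomogeneous (d - 3)) →
      ∑ i, θ i * pderiv i F = 0 → θ = 0)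
    (g : MvPolynomial (Fin 3) ℂ) (hg : g.IsHomogeneous (d - 3)) (hv : ∀ p ∈ Sf, VanAt g p) :
    g = 0 := by
  obtain ⟨γ, hγ, ha, hb⟩ := exists_perp α β
  obtain ⟨j, hj⟩ := Function.ne_iff.1 hγ
  have hdj : (pderiv j F).IsHomogeneous (d - 1) := hF.pderiv
  have hgj := hg.mul hdj
  have hmem := h.noether hgj (by
    intro p hp
    rcases hT p hp with h1 | h1
    · have := hv p h1
      simp only [VanAt] at this ⊢
      simp [this]
    · have := h1 j
      simp only [VanAt] at this ⊢
      simp [this])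
  obtain ⟨u, w, e⟩ := Ideal.mem_span_pair.1 hmem
  have e' := hom_decomp hgj h.h1 h.h2 e.symm
  have hA := tc_hom u (d - 1) (d - 3 + (d - 1))
  have hB := tc_hom w (d - 1) (d - 3 + (d - 1))
  rw [Nat.add_sub_cancel] at hA hB
  generalize tc u (d - 1) (d - 3 + (d - 1)) = A at hA e'
  generalize tc w (d - 1) (d - 3 + (d - 1)) = B at hB e'
  have hθ := hsyz (fun i => (if i = j then g else 0) - C (α i) * A - C (β i) * B) (by
    intro i
    refine IsHomogeneous.sub (IsHomogeneous.sub ?_ (hA.C_mul _)) (hB.C_mul _)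
    split_ifs
    · exact hg
    · exact isHomogeneous_zero _ _ _) (by
    simp only [sub_mul, Finset.sum_sub_distrib, ite_mul, zero_mul, Finset.sum_ite_eq',
      Finset.mem_univ, if_true]
    rw [e']
    simp only [Fin.sum_univ_three]
    ring)
  have hsum : ∑ i, C (γ i) * ((if i = j then g else 0) - C (α i) * A - C (β i) * B) = 0 := by
    refine Finset.sum_eq_zero fun i _ => ?_
    have := congrFun hθ i
    simp only [Pi.zero_apply] at this
    rw [this, mul_zero]
  have ha' : ∑ i, (C (γ i) * C (α i) : MvPolynomial (Fin 3) ℂ) = 0 := by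
    simp only [← C_mul, ← map_sum, ha, C_0]
  have hb' : ∑ i, (C (γ i) * C (β i) : MvPolynomial (Fin 3) ℂ) = 0 := by
    simp only [← C_mul, ← map_sum, hb, C_0]
  have : C (γ j) * g = 0 := by
    simp only [mul_sub, Finset.sum_sub_distrib, mul_ite, mul_zero, Finset.sum_ite_eq',
      Finset.mem_univ, if_true, ← mul_assoc, ← Finset.sum_mul, ha', hb', zero_mul, sub_zero] at hsum
    exact hsum
  rcases mul_eq_zero.1 this with h0 | h0
  · exact absurd (C_eq_zero.1 h0) hj
  · exact h0

theorem stmt_6 (d : ℕ) (hd : 3 ≤ d) (F : MvPolynomial (Fin 3) ℂ)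
    (hF : F.IsHomogeneous d) (hirr : Irreducible F) (hnodal : Nodal F)
    (hfin : (nodes F).Finite)
    (hn : (nodes F).ncard ≤ (d - 1).choose 2 - 1)
    (F₁ F₂ : MvPolynomial (Fin 3) ℂ)
    (hmem1 : F₁ ∈ Submodule.span ℂ {pderiv 0 F, pderiv 1 F, pderiv 2 F})
    (hmem2 : F₂ ∈ Submodule.span ℂ {pderiv 0 F, pderiv 1 F, pderiv 2 F})
    (hli : LinearIndependent ℂ ![F₁, F₂])
    (S : Set P2) (hSfin : S.Finite)
    (hScard : S.ncard = (d - 1) ^ 2 - (nodes F).ncard)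
    (hSdisj : Disjoint S (nodes F))
    (hzero : zeroSet F₁ F₂ = nodes F ∪ S) :
    ∃ Z Y : Set P2, Disjoint Z Y ∧ Z ∪ Y = S ∧
      Z.ncard = d.choose 2 - (nodes F).ncard ∧ Y.ncard = (d - 1).choose 2 ∧
      (∀ G : MvPolynomial (Fin 3) ℂ, G.IsHomogeneous (d - 2) →
        (∀ p ∈ Z ∪ nodes F, VanAt G p) → G = 0) ∧
      (∀ G : MvPolynomial (Fin 3) ℂ, G.IsHomogeneous (d - 3) →
        (∀ p ∈ Y, VanAt G p) → G = 0) := by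
  classical
  obtain ⟨α, rfl⟩ := span_form hmem1
  obtain ⟨β, rfl⟩ := span_form hmem2
  obtain ⟨k, rfl⟩ : ∃ k, d = k + 3 := ⟨d - 3, by omega⟩
  set n := (nodes F).ncard with hn_def
  have c1 := choose_two_aux k
  have c2 := choose_two_aux (k + 1)
  have e1 : k + 3 - 1 = k + 2 := rfl
  have e2 : k + 3 - 2 = k + 1 := rfl
  have e3 : k + 3 - 3 = k := rfl
  rw [e1] at hn hScard
  have hchle : (k + 2).choose 2 ≤ (k + 2) ^ 2 := by nlinarith
  let Δ := hfin.toFinset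
  let Sf := hSfin.toFinset
  have hΔcard : Δ.card = n := (Set.ncard_eq_toFinset_card _ hfin).symm
  have hSfcard : Sf.card = (k + 2) ^ 2 - n := by
    rw [← hScard]; exact (Set.ncard_eq_toFinset_card _ hSfin).symm
  have hdisj : Disjoint Δ Sf := by
    rw [Finset.disjoint_left]
    intro p hp hp'
    exact Set.disjoint_left.1 hSdisj (hSfin.mem_toFinset.1 hp') (hfin.mem_toFinset.1 hp)
  obtain ⟨a, ha2, hav⟩ := exists_avoid (Δ ∪ Sf)
  have hCI : CI (∑ i, C (α i) * pderiv i F) (∑ i, C (β i) * pderiv i F) (k + 2) (Δ ∪ Sf) a := by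
    refine ⟨form_hom hF α, form_hom hF β, ?_, ?_, by omega, ha2, hav⟩
    · intro p
      have : p ∈ zeroSet (∑ i, C (α i) * pderiv i F) (∑ i, C (β i) * pderiv i F) ↔
          p ∈ nodes F ∪ S := by rw [hzero]
      rw [Finset.mem_union, hfin.mem_toFinset, hSfin.mem_toFinset]
      exact this.symm
    · rw [Finset.card_union_of_disjoint hdisj, hΔcard, hSfcard]
      omega
  have hT : ∀ p ∈ Δ ∪ Sf, p ∈ Sf ∨ SingPt F p := by
    intro p hp
    rcases Finset.mem_union.1 hp with h | h
    · exact Or.inr (hfin.mem_toFinset.1 h).1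
    · exact Or.inl h
  have hsing : ∀ p, SingPt F p → p ∈ Δ := fun p hp => hfin.mem_toFinset.2 (hnodal p hp)
  have hle : Ideal.span {∑ i, C (α i) * pderiv i F, ∑ i, C (β i) * pderiv i F} ≤ Jac F := by
    rw [Ideal.span_le]
    rintro x (rfl | rfl)
    · exact form_jac F α
    · exact form_jac F β
  have hsyz := no_syz hd hF hirr hnodal a ha2
    (fun p hp => hav p (Finset.mem_union_left _ (hsing p hp)))
    (colon_pow hF hCI hle Sf
      (fun p hp hs => Finset.disjoint_left.1 hdisj (hsing p hs) hp) hT)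
  obtain ⟨Y, hYS, hYc, hY0, hYsep⟩ := min_subset Sf k
    (alpha_claim hd hF hCI Sf hT (fun θ => hsyz θ))
  refine ⟨↑(Sf \ Y), ↑Y, ?_, ?_, ?_, ?_, ?_, ?_⟩
  · rw [Finset.disjoint_coe]
    exact Finset.sdiff_disjoint
  · rw [← Finset.coe_union, Finset.sdiff_union_of_subset hYS]
    exact hSfin.coe_toFinset
  · rw [Set.ncard_coe_finset, Finset.card_sdiff_of_subset hYS, hSfcard, hYc]
    have : (k + 2) ^ 2 = (k + 3).choose 2 + (k + 2).choose 2 := by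
      have c2' : 2 * (k + 3).choose 2 = (k + 3) * (k + 2) := c2
      nlinarith
    omega
  · rw [Set.ncard_coe_finset, hYc, e1]
  · intro G hG hGv
    rw [e2] at hG
    refine hCI.noether_small (t := k + 1) (by omega) hG ?_
    have hout : ∀ p ∈ Δ ∪ Sf, p ∉ Y → VanAt G p := by
      intro p hp hpY
      apply hGv
      rcases Finset.mem_union.1 hp with h | h
      · exact Or.inr (hfin.mem_toFinset.1 h)
      · exact Or.inl (Finset.mem_coe.2 (Finset.mem_sdiff.2 ⟨h, hpY⟩))
    intro p hp
    by_cases hpY : p ∈ Y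
    · obtain ⟨g, hg, hg1, hg2⟩ := hYsep p hpY
      have := hCI.cb p hp (k + 1 + k) (by omega) (G * g) (hG.mul hg) (by
        intro q hq hqp
        by_cases hqY : q ∈ Y
        · have := hg1 q hqY hqp
          simp only [VanAt] at this ⊢
          simp [this]
        · have := hout q hq hqY
          simp only [VanAt] at this ⊢
          simp [this])
      simp only [VanAt, map_mul] at this hg2 ⊢
      exact (mul_eq_zero.1 this).resolve_right hg2
    · exact hout p hp hpY
  · intro G hG hGv
    exact hY0 G hG hGv

end
end

section
/- Let F ∈ ℂ[X,Y,Z] be an irreducible homogeneous polynomial of degree d ≥ 3 whose curve F = 0 has only nodes as singularities, let Δ be the set of nodes and n = |Δ|. Then for every integer k ≥ d − 3 the set Δ imposes independent conditions on homogeneous forms of degree k; that is, dim V_k(Δ) = binom(k+2, 2) − n. In particular dim V_{d−3}(Δ) = binom(d−1, 2) − n, the geometric genus of the curve F = 0. -/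
open MvPolynomial

noncomputable section

section partA

attribute [local instance] MvPolynomial.gradedAlgebra

lemma hc_mul_right {σ : Type*} {e : ℕ} (a P : MvPolynomial σ ℂ) (hP : P.IsHomogeneous e) (k : ℕ) :
    homogeneousComponent (k + e) (a * P) = homogeneousComponent k a * P := by
  have h := DirectSum.coe_decompose_mul_of_right_mem_of_le (𝒜 := homogeneousSubmodule σ ℂ) (a := a)
    (b := P) (i := e) (n := k + e) hP (by omega)
  rw [Nat.add_sub_cancel] at h
  have h2 := decomposition.decompose'_apply (a * P) (k + e)
  have h3 := decomposition.decompose'_apply a k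
  rw [← h2, ← h3]
  exact h

lemma hc_mul_right_lt {σ : Type*} {e : ℕ} (a P : MvPolynomial σ ℂ) (hP : P.IsHomogeneous e)
    (k : ℕ) (hk : k < e) : homogeneousComponent k (a * P) = 0 := by
  have h := DirectSum.coe_decompose_mul_of_right_mem_of_not_le (𝒜 := homogeneousSubmodule σ ℂ)
    (a := a) (b := P) (i := e) (n := k) hP (by omega)
  have h2 := decomposition.decompose'_apply (a * P) k
  rw [← h2]
  exact h

lemma mem_pair_homog {σ : Type*} {e k : ℕ} {P Q G : MvPolynomial σ ℂ} (hP : P.IsHomogeneous e)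
    (hQ : Q.IsHomogeneous e) (hG : G.IsHomogeneous (k + e)) (h : G ∈ Ideal.span {P, Q}) :
    ∃ a b : MvPolynomial σ ℂ, a.IsHomogeneous k ∧ b.IsHomogeneous k ∧ G = a * P + b * Q := by
  obtain ⟨a, b, hab⟩ := Ideal.mem_span_pair.1 h
  refine ⟨homogeneousComponent k a, homogeneousComponent k b, homogeneousComponent_isHomogeneous _ _,
    homogeneousComponent_isHomogeneous _ _, ?_⟩
  rw [← hc_mul_right _ _ hP, ← hc_mul_right _ _ hQ, ← map_add, hab, homogeneousComponent_eq_self hG]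

lemma mem_pair_homog_lt {σ : Type*} {e k : ℕ} {P Q G : MvPolynomial σ ℂ} (hP : P.IsHomogeneous e)
    (hQ : Q.IsHomogeneous e) (hG : G.IsHomogeneous k) (hk : k < e) (h : G ∈ Ideal.span {P, Q}) :
    G = 0 := by
  obtain ⟨a, b, hab⟩ := Ideal.mem_span_pair.1 h
  rw [← homogeneousComponent_eq_self hG, ← hab, map_add, hc_mul_right_lt _ _ hP _ hk,
    hc_mul_right_lt _ _ hQ _ hk, add_zero]

/-- A homogeneous multiple of lower degree vanishes. -/
lemma dvd_homog_lt {σ : Type*} {e k : ℕ} {P G : MvPolynomial σ ℂ} (hP : P.IsHomogeneous e)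
    (hG : G.IsHomogeneous k) (hk : k < e) (h : P ∣ G) : G = 0 := by
  refine mem_pair_homog_lt hP hP hG hk ?_
  simpa [Ideal.mem_span_singleton] using h

lemma finrank_homog (m k : ℕ) :
    Module.finrank ℂ (homogeneousSubmodule (Fin m) ℂ k) = m.multichoose k := by
  classical
  have e2 : Module.finrank ℂ (homogeneousSubmodule (Fin m) ℂ k) =
      Module.finrank ℂ ({d : Fin m →₀ ℕ | d.degree = k} →₀ ℂ) := by
    rw [homogeneousSubmodule_eq_finsupp_supported]
    exact LinearEquiv.finrank_eq (AddMonoidAlgebra.supportedEquivFinsupp _)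
  have hset : {d : Fin m →₀ ℕ | d.degree = k} =
      ((Finset.finsuppAntidiag Finset.univ k : Finset (Fin m →₀ ℕ)) : Set (Fin m →₀ ℕ)) := by
    ext d
    simp [Finsupp.degree_eq_sum, Finset.mem_finsuppAntidiag]
  rw [e2, hset]
  rw [Module.finrank_finsupp_self]
  simp [Finset.card_finsuppAntidiag_nat_eq_multichoose]

instance finite_homog (m k : ℕ) : Module.Finite ℂ (homogeneousSubmodule (Fin m) ℂ k) :=
  Module.Finite.iff_fg.2 (homogeneousSubmodule_fg _ _ k)

lemma eval_smul_homog {σ : Type*} {k : ℕ} {G : MvPolynomial σ ℂ} (hG : G.IsHomogeneous k)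
    {A : Type*} [CommRing A] [Algebra ℂ A] (c : A) (v : σ → A) :
    aeval (fun i => c * v i) G = c ^ k * aeval v G := by
  rw [aeval_def, aeval_def, eval₂_eq, eval₂_eq, Finset.mul_sum]
  refine Finset.sum_congr rfl fun m hm => ?_
  have hk := hG.degree_eq_sum_deg_support hm
  simp_rw [mul_pow]
  rw [Finset.prod_mul_distrib, Finset.prod_pow_eq_pow_sum, ← hk]
  ring

end partA

section partB

/-- Koszul relation for relatively prime elements. -/
lemma koszul_s9 {R : Type*} [CommRing R] [IsDomain R] [DecompositionMonoid R] {p q a b : R}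
    (hp : p ≠ 0) (hpq : IsRelPrime p q) (h : a * p + b * q = 0) :
    ∃ t, a = t * q ∧ b = -(t * p) := by
  have h1 : p ∣ b * q := ⟨-a, by linear_combination h⟩
  obtain ⟨c, hc⟩ := hpq.dvd_of_dvd_mul_right h1
  refine ⟨-c, ?_, by rw [hc]; ring⟩
  apply mul_right_cancel₀ hp
  rw [hc] at h
  linear_combination h

variable {e : ℕ} {p q : MvPolynomial (Fin 2) ℂ}

/-- the map `(a,b) ↦ a p + b q` on forms of degree `k`. -/
def pairMap (p q : MvPolynomial (Fin 2) ℂ) (hp : p.IsHomogeneous e)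
    (hq : q.IsHomogeneous e) (k : ℕ) :
    (homogeneousSubmodule (Fin 2) ℂ k × homogeneousSubmodule (Fin 2) ℂ k) →ₗ[ℂ]
      homogeneousSubmodule (Fin 2) ℂ (k + e) where
  toFun x := ⟨x.1.1 * p + x.2.1 * q, (IsHomogeneous.mul x.1.2 hp).add (IsHomogeneous.mul x.2.2 hq)⟩
  map_add' x y := by ext1; simp; ring
  map_smul' c x := by ext1; simp [smul_add]

lemma pairMap_inj (hp : p.IsHomogeneous e) (hq : q.IsHomogeneous e) (hp0 : p ≠ 0)
    (hpq : IsRelPrime p q) {k : ℕ} (hk : k < e) : Function.Injective (pairMap p q hp hq k) := by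
  rw [← LinearMap.ker_eq_bot, LinearMap.ker_eq_bot']
  rintro ⟨⟨a, ha⟩, ⟨b, hb⟩⟩ h
  have h' : a * p + b * q = 0 := congrArg Subtype.val h
  obtain ⟨t, h1, h2⟩ := koszul_s9 hp0 hpq h'
  have hb0 : b = 0 := dvd_homog_lt hp hb hk ⟨-t, by rw [h2]; ring⟩
  have ha0 : a = 0 := dvd_homog_lt hq ha hk ⟨t, by rw [h1]; ring⟩
  subst hb0; subst ha0; rfl

lemma mem_pair_of_range (hp : p.IsHomogeneous e) (hq : q.IsHomogeneous e) {k : ℕ}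
    {x : homogeneousSubmodule (Fin 2) ℂ (k + e)} :
    x ∈ LinearMap.range (pairMap p q hp hq k) ↔ x.1 ∈ Ideal.span {p, q} := by
  constructor
  · rintro ⟨y, rfl⟩
    exact Ideal.mem_span_pair.2 ⟨_, _, rfl⟩
  · intro h
    obtain ⟨a, b, ha, hb, hab⟩ := mem_pair_homog hp hq x.2 h
    exact ⟨(⟨a, ha⟩, ⟨b, hb⟩), Subtype.ext hab.symm⟩

lemma finrank_two (k : ℕ) : Module.finrank ℂ (homogeneousSubmodule (Fin 2) ℂ k) = k + 1 := by
  rw [finrank_homog, Nat.multichoose_two]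

lemma binary_top (he : 1 ≤ e) (hp : p.IsHomogeneous e) (hq : q.IsHomogeneous e) (hp0 : p ≠ 0)
    (hpq : IsRelPrime p q) {u : MvPolynomial (Fin 2) ℂ} (hu : u.IsHomogeneous (e - 1 + e)) :
    u ∈ Ideal.span {p, q} := by
  have hinj := pairMap_inj hp hq hp0 hpq (k := e - 1) (by omega)
  have hsurj : Function.Surjective (pairMap p q hp hq (e - 1)) := by
    refine (LinearMap.injective_iff_surjective_of_finrank_eq_finrank ?_).1 hinj
    rw [Module.finrank_prod, finrank_two, finrank_two]; omega
  have := (mem_pair_of_range hp hq (x := ⟨u, hu⟩)).1 (hsurj _)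
  exact this

lemma binary_high (he : 1 ≤ e) (hp : p.IsHomogeneous e) (hq : q.IsHomogeneous e) (hp0 : p ≠ 0)
    (hpq : IsRelPrime p q) (k : ℕ) {u : MvPolynomial (Fin 2) ℂ}
    (hu : u.IsHomogeneous (k + (e - 1 + e))) :
    u ∈ Ideal.span {p, q} := by
  induction k generalizing u with
  | zero => exact binary_top he hp hq hp0 hpq (by simpa using hu)
  | succ k ih =>
    rw [u.as_sum]
    refine Ideal.sum_mem _ fun m hm => ?_
    have hdeg := hu.degree_eq_sum_deg_support hm
    have : ∃ i : Fin 2, m i ≠ 0 := by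
      by_contra hcon
      push Not at hcon
      have : m = 0 := Finsupp.ext hcon
      subst this
      simp at hdeg
    obtain ⟨i, hi⟩ := this
    have hm' : m = (m - Finsupp.single i 1) + Finsupp.single i 1 := by
      ext j
      by_cases hj : i = j
      · subst hj; simp; omega
      · simp [hj]
    rw [hm', monomial_add_single, pow_one]
    refine Ideal.mul_mem_right _ _ (ih (isHomogeneous_monomial _ ?_))
    have h1 : m.degree = k + 1 + (e - 1 + e) := by rw [hdeg]; rfl
    rw [hm', map_add, Finsupp.degree_single] at h1
    omega

/-- A functional on forms of degree `2e-2` with kernel exactly the ideal. -/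
lemma binary_socle_functional (he : 2 ≤ e) (hp : p.IsHomogeneous e) (hq : q.IsHomogeneous e)
    (hp0 : p ≠ 0) (hpq : IsRelPrime p q) :
    ∃ τ : homogeneousSubmodule (Fin 2) ℂ (e - 2 + e) →ₗ[ℂ] ℂ,
      ∀ x, τ x = 0 ↔ x.1 ∈ Ideal.span {p, q} := by
  have hinj := pairMap_inj hp hq hp0 hpq (k := e - 2) (by omega)
  set W := LinearMap.range (pairMap p q hp hq (e - 2)) with hW
  have h1 : Module.finrank ℂ W = 2 * (e - 1) := by
    rw [LinearMap.finrank_range_of_inj hinj, Module.finrank_prod, finrank_two]; omega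
  have h2 : Module.finrank ℂ (homogeneousSubmodule (Fin 2) ℂ (e - 2 + e) ⧸ W) = 1 := by
    have := W.finrank_quotient_add_finrank
    rw [h1, finrank_two] at this; omega
  have eq := LinearEquiv.ofFinrankEq (R := ℂ) _ ℂ (h2.trans (Module.finrank_self ℂ).symm)
  refine ⟨eq.toLinearMap ∘ₗ W.mkQ, fun x => ?_⟩
  rw [← mem_pair_of_range hp hq, ← hW]
  simp

lemma binary_socle (he : 2 ≤ e) (hp : p.IsHomogeneous e) (hq : q.IsHomogeneous e)
    (hp0 : p ≠ 0) (hpq : IsRelPrime p q) {k : ℕ} (hk : k < e - 2 + e) {u : MvPolynomial (Fin 2) ℂ}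
    (hu : u.IsHomogeneous k) (hx : u * X 0 ∈ Ideal.span {p, q}) (hy : u * X 1 ∈ Ideal.span {p, q}) :
    u ∈ Ideal.span {p, q} := by
  have hux := hu.mul (isHomogeneous_X ℂ (0 : Fin 2))
  have huy := hu.mul (isHomogeneous_X ℂ (1 : Fin 2))
  have hX0 : (X 0 : MvPolynomial (Fin 2) ℂ) ≠ 0 := X_ne_zero _
  have hX1 : (X 1 : MvPolynomial (Fin 2) ℂ) ≠ 0 := X_ne_zero _
  by_cases hlt : k + 1 < e
  · have := mem_pair_homog_lt hp hq hux hlt hx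
    have hu0 : u = 0 := by simpa using this
    rw [hu0]; exact Ideal.zero_mem _
  obtain ⟨m, hm⟩ : ∃ m, k + 1 = m + e := ⟨k + 1 - e, by omega⟩
  rw [hm] at hux huy
  obtain ⟨a, b, ha, hb, hab⟩ := mem_pair_homog hp hq hux hx
  obtain ⟨c, d, hc, hd, hcd⟩ := mem_pair_homog hp hq huy hy
  have hkos : (X 1 * a - X 0 * c) * p + (X 1 * b - X 0 * d) * q = 0 := by
    linear_combination (-X 1) * hab + X 0 * hcd
  have hm1 : 1 + m < e := by omega
  obtain ⟨t, h1, h2⟩ := koszul_s9 hp0 hpq hkos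
  have h3 : X 1 * a - X 0 * c = 0 :=
    dvd_homog_lt hq (((isHomogeneous_X ℂ _).mul ha).sub ((isHomogeneous_X ℂ _).mul hc)) hm1
      ⟨t, by rw [h1]; ring⟩
  have h4 : X 1 * b - X 0 * d = 0 :=
    dvd_homog_lt hp (((isHomogeneous_X ℂ _).mul hb).sub ((isHomogeneous_X ℂ _).mul hd)) hm1
      ⟨-t, by rw [h2]; ring⟩
  have hprime : Prime (X 0 : MvPolynomial (Fin 2) ℂ) := X_prime
  have hnd : ¬ (X 0 : MvPolynomial (Fin 2) ℂ) ∣ X 1 := by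
    rw [X_dvd_X]; simp
  obtain ⟨a', ha'⟩ := (hprime.dvd_or_dvd (a := X 1) (b := a) ⟨c, by linear_combination h3⟩).resolve_left hnd
  obtain ⟨b', hb'⟩ := (hprime.dvd_or_dvd (a := X 1) (b := b) ⟨d, by linear_combination h4⟩).resolve_left hnd
  refine Ideal.mem_span_pair.2 ⟨a', b', ?_⟩
  apply mul_left_cancel₀ hX0
  rw [ha', hb'] at hab
  linear_combination -hab

lemma binary_dual (he : 2 ≤ e) (hp : p.IsHomogeneous e) (hq : q.IsHomogeneous e)
    (hp0 : p ≠ 0) (hpq : IsRelPrime p q) (j : ℕ) : ∀ {k : ℕ} (_ : k + j = e - 2 + e)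
    {u : MvPolynomial (Fin 2) ℂ} (_ : u.IsHomogeneous k) (_ : u ∉ Ideal.span {p, q}),
    ∃ v : MvPolynomial (Fin 2) ℂ, v.IsHomogeneous j ∧ u * v ∉ Ideal.span {p, q} := by
  induction j with
  | zero => intro k hk u hu hn; exact ⟨1, isHomogeneous_one _ _, by simpa using hn⟩
  | succ j ih =>
    intro k hk u hu hn
    have : ∃ i : Fin 2, u * X i ∉ Ideal.span {p, q} := by
      by_contra hcon
      push Not at hcon
      exact hn (binary_socle he hp hq hp0 hpq (by omega) hu (hcon 0) (hcon 1))
    obtain ⟨i, hi⟩ := this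
    obtain ⟨v, hv, hv'⟩ := ih (k := k + 1) (by omega) (hu.mul (isHomogeneous_X ℂ i)) hi
    refine ⟨X i * v, ?_, by rwa [← mul_assoc]⟩
    rw [add_comm]
    exact (isHomogeneous_X ℂ i).mul hv

end partB

section partC

lemma exists_factor {V W : Type*} [AddCommGroup V] [Module ℂ V] [AddCommGroup W] [Module ℂ W]
    (g : V →ₗ[ℂ] W) (hg : Function.Surjective g) (κ : V →ₗ[ℂ] ℂ) (h : ∀ x, g x = 0 → κ x = 0) :
    ∃ ρ : W →ₗ[ℂ] ℂ, ∀ x, ρ (g x) = κ x := by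
  obtain ⟨s, hs⟩ := g.exists_rightInverse_of_surjective (LinearMap.range_eq_top.2 hg)
  refine ⟨κ ∘ₗ s, fun x => ?_⟩
  have h1 : g (s (g x)) = g x := by
    have := LinearMap.congr_fun hs (g x)
    simpa using this
  have h2 : κ (s (g x) - x) = 0 := h _ (by rw [map_sub, h1, sub_self])
  rw [map_sub, sub_eq_zero] at h2
  simpa using h2

lemma hc_mem_pair {σ : Type*} {e : ℕ} {P Q G : MvPolynomial σ ℂ} (hP : P.IsHomogeneous e)
    (hQ : Q.IsHomogeneous e) (h : G ∈ Ideal.span {P, Q}) (n : ℕ) :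
    homogeneousComponent n G ∈ Ideal.span {P, Q} := by
  obtain ⟨a, b, rfl⟩ := Ideal.mem_span_pair.1 h
  rw [map_add]
  by_cases hn : n < e
  · rw [hc_mul_right_lt _ _ hP _ hn, hc_mul_right_lt _ _ hQ _ hn, add_zero]
    exact Ideal.zero_mem _
  · obtain ⟨m, rfl⟩ : ∃ m, n = m + e := ⟨n - e, by omega⟩
    rw [hc_mul_right _ _ hP, hc_mul_right _ _ hQ]
    exact Ideal.mem_span_pair.2 ⟨_, _, rfl⟩

variable {e : ℕ} {P Q L : MvPolynomial (Fin 3) ℂ}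
  {π : MvPolynomial (Fin 3) ℂ →ₐ[ℂ] MvPolynomial (Fin 2) ℂ}
  {ι : MvPolynomial (Fin 2) ℂ →ₐ[ℂ] MvPolynomial (Fin 3) ℂ}

lemma dvd_of_pi (hker : ∀ G, L ∣ G - ι (π G)) {G : MvPolynomial (Fin 3) ℂ} (h : π G = 0) :
    L ∣ G := by
  have := hker G
  rwa [h, map_zero, sub_zero] at this

lemma core_nzd (hL0 : L ≠ 0) (hπι : ∀ u, π (ι u) = u) (hπL : π L = 0)
    (hker : ∀ G, L ∣ G - ι (π G)) (hp0 : π P ≠ 0) (hpq : IsRelPrime (π P) (π Q))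
    {u : MvPolynomial (Fin 3) ℂ} (h : L * u ∈ Ideal.span {P, Q}) : u ∈ Ideal.span {P, Q} := by
  obtain ⟨a, b, hab⟩ := Ideal.mem_span_pair.1 h
  have h1 : π a * π P + π b * π Q = 0 := by
    rw [← map_mul, ← map_mul, ← map_add, hab, map_mul, hπL, zero_mul]
  obtain ⟨t, ha, hb⟩ := koszul_s9 hp0 hpq h1
  obtain ⟨a', ha'⟩ := dvd_of_pi hker (G := a - ι t * Q) (by simp [hπι, ha])
  obtain ⟨b', hb'⟩ := dvd_of_pi hker (G := b + ι t * P) (by simp [hπι, hb])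
  refine Ideal.mem_span_pair.2 ⟨a', b', ?_⟩
  apply mul_left_cancel₀ hL0
  linear_combination hab - P * ha' - Q * hb'

lemma core_homog (hP : P.IsHomogeneous e) (hQ : Q.IsHomogeneous e) (hL : L.IsHomogeneous 1)
    (hnzd : ∀ u, L * u ∈ Ideal.span {P, Q} → u ∈ Ideal.span {P, Q}) {k : ℕ}
    {w : MvPolynomial (Fin 3) ℂ} (hw : w.IsHomogeneous k)
    (h : w ∈ Ideal.span {P, Q} ⊔ Ideal.span {L - 1}) : w ∈ Ideal.span {P, Q} := by
  set I := Ideal.span {P, Q} with hI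
  let l : MvPolynomial (Fin 3) ℂ ⧸ I := Ideal.Quotient.mk I L
  let Loc := Localization.Away l
  let inv : Loc := IsLocalization.Away.invSelf l
  have hinv : algebraMap _ Loc l * inv = 1 := IsLocalization.Away.mul_invSelf l
  let g : MvPolynomial (Fin 3) ℂ →ₐ[ℂ] Loc :=
    (Algebra.ofId (MvPolynomial (Fin 3) ℂ ⧸ I) Loc).restrictScalars ℂ |>.comp (Ideal.Quotient.mkₐ ℂ I)
  have hg : ∀ G, g G = algebraMap _ Loc (Ideal.Quotient.mk I G) := fun G => rfl
  let f : MvPolynomial (Fin 3) ℂ →ₐ[ℂ] Loc := aeval (fun i => inv * g (X i))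
  have hf : ∀ {n : ℕ} {G : MvPolynomial (Fin 3) ℂ}, G.IsHomogeneous n → f G = inv ^ n * g G := by
    intro n G hG
    have h1 := eval_smul_homog hG inv (fun i => g (X i))
    have h2 : aeval (fun i => g (X i)) G = g G := by
      rw [← comp_aeval_apply]; simp
    rw [h2] at h1
    exact h1
  have hgI : ∀ G ∈ I, g G = 0 := by
    intro G hG
    rw [hg, Ideal.Quotient.eq_zero_iff_mem.2 hG, map_zero]
  have hfw : f w = 0 := by
    have hle : I ⊔ Ideal.span {L - 1} ≤ RingHom.ker f := by
      refine sup_le ?_ ?_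
      · refine Ideal.span_le.2 ?_
        rintro x (rfl | rfl)
        · change f _ = 0
          rw [hf hP, hgI _ (Ideal.subset_span (by simp)), mul_zero]
        · change f _ = 0
          rw [hf hQ, hgI _ (Ideal.subset_span (by simp)), mul_zero]
      · rw [Ideal.span_le]
        rintro x rfl
        change f _ = 0
        rw [map_sub, map_one, hf hL, pow_one, hg, mul_comm, hinv, sub_self]
    exact hle h
  rw [hf hw] at hfw
  have hu : IsUnit (inv ^ k) := (IsUnit.of_mul_eq_one _ (by rw [mul_comm]; exact hinv)).pow k
  rw [hu.mul_right_eq_zero, hg] at hfw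
  have hlreg : l ∈ nonZeroDivisors (MvPolynomial (Fin 3) ℂ ⧸ I) := by
    rw [mem_nonZeroDivisors_iff_right]
    intro x hx
    obtain ⟨x, rfl⟩ := Ideal.Quotient.mk_surjective x
    rw [← map_mul, Ideal.Quotient.eq_zero_iff_mem, mul_comm] at hx
    exact Ideal.Quotient.eq_zero_iff_mem.2 (hnzd _ hx)
  have hinj : Function.Injective (algebraMap (MvPolynomial (Fin 3) ℂ ⧸ I) Loc) :=
    IsLocalization.injective Loc (M := Submonoid.powers l) (by
      rw [Submonoid.powers_le]; exact hlreg)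
  rw [map_eq_zero_iff _ hinj, Ideal.Quotient.eq_zero_iff_mem] at hfw
  exact hfw

lemma core_lift (hP : P.IsHomogeneous e) (hQ : Q.IsHomogeneous e) (hL : L.IsHomogeneous 1)
    (hπι : ∀ u, π (ι u) = u) (hker : ∀ G, L ∣ G - ι (π G))
    {k : ℕ} {G : MvPolynomial (Fin 3) ℂ} (hG : G.IsHomogeneous (k + 1))
    (h : π G ∈ Ideal.span {π P, π Q}) :
    ∃ G' : MvPolynomial (Fin 3) ℂ, G'.IsHomogeneous k ∧ G - G' * L ∈ Ideal.span {P, Q} := by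
  obtain ⟨a, b, hab⟩ := Ideal.mem_span_pair.1 h
  obtain ⟨g, hg⟩ := dvd_of_pi hker (G := G - (ι a * P + ι b * Q)) (by simp [hπι, hab])
  have hc : ι a * P + ι b * Q ∈ Ideal.span {P, Q} := Ideal.mem_span_pair.2 ⟨_, _, rfl⟩
  refine ⟨homogeneousComponent k g, homogeneousComponent_isHomogeneous _ _, ?_⟩
  have h2 := hc_mem_pair hP hQ hc (k + 1)
  rw [← hc_mul_right _ _ hL, ← homogeneousComponent_eq_self hG, mul_comm g, ← hg,
    homogeneousComponent_eq_self hG, map_sub, homogeneousComponent_eq_self hG]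
  simpa using h2

/-- The key duality lemma. -/
lemma core (he : 2 ≤ e) (hP : P.IsHomogeneous e) (hQ : Q.IsHomogeneous e) (hL : L.IsHomogeneous 1)
    (hL0 : L ≠ 0) (hπι : ∀ u, π (ι u) = u) (hπL : π L = 0)
    (hker : ∀ G, L ∣ G - ι (π G))
    (hπh : ∀ {k : ℕ} {G : MvPolynomial (Fin 3) ℂ}, G.IsHomogeneous k → (π G).IsHomogeneous k)
    (hιh : ∀ {k : ℕ} {G : MvPolynomial (Fin 2) ℂ}, G.IsHomogeneous k → (ι G).IsHomogeneous k)
    (hp0 : π P ≠ 0) (hpq : IsRelPrime (π P) (π Q))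
    {R : MvPolynomial (Fin 3) ℂ} (hR : R.IsHomogeneous e)
    (φ : MvPolynomial (Fin 3) ℂ →ₗ[ℂ] ℂ) (hφ : φ ≠ 0)
    (hφP : ∀ G, φ (G * P) = 0) (hφQ : ∀ G, φ (G * Q) = 0) (hφR : ∀ G, φ (G * R) = 0)
    (hφL : ∀ G, φ (G * L) = φ G) (hφd : ∀ G, G.IsHomogeneous (e - 2) → φ G = 0) :
    ∃ A : MvPolynomial (Fin 3) ℂ, A.IsHomogeneous (e - 1) ∧ A ≠ 0 ∧ A * R ∈ Ideal.span {P, Q} := by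
  have hnzd : ∀ u, L * u ∈ Ideal.span {P, Q} → u ∈ Ideal.span {P, Q} :=
    fun u => core_nzd hL0 hπι hπL hker hp0 hpq
  have hpow : ∀ {k : ℕ} {G : MvPolynomial (Fin 3) ℂ}, G.IsHomogeneous k → ∀ j,
      (G * L ^ j).IsHomogeneous (k + j) := by
    intro k G hG j
    have := hG.mul (hL.pow j)
    rwa [one_mul] at this
  set I : Ideal (MvPolynomial (Fin 3) ℂ) := Ideal.span {P, Q} ⊔ Ideal.span {L - 1} with hI
  have hPI : Ideal.span {P, Q} ≤ I := le_sup_left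
  let mk : MvPolynomial (Fin 3) ℂ →ₐ[ℂ] (MvPolynomial (Fin 3) ℂ ⧸ I) := Ideal.Quotient.mkₐ ℂ I
  have hmk : ∀ G, mk G = 0 ↔ G ∈ I := fun G => Ideal.Quotient.eq_zero_iff_mem
  have hmks : Function.Surjective mk := Ideal.Quotient.mk_surjective
  have hmkL : mk L = 1 := by
    have : mk (L - 1) = 0 := (hmk _).2 (le_sup_right (a := Ideal.span {P, Q})
      (Ideal.subset_span rfl))
    rwa [map_sub, map_one, sub_eq_zero] at this
  -- everything is represented in degree `D`
  have hall : ∀ k, ∀ G : MvPolynomial (Fin 3) ℂ, G.IsHomogeneous k →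
      ∃ G' : MvPolynomial (Fin 3) ℂ, G'.IsHomogeneous (e - 2 + e) ∧ mk G' = mk G := by
    intro k
    induction k with
    | zero =>
      intro G hG
      refine ⟨G * L ^ (e - 2 + e), ?_, by simp [hmkL]⟩
      simpa using hpow hG (e - 2 + e)
    | succ k ih =>
      intro G hG
      by_cases hk : k + 1 ≤ e - 2 + e
      · refine ⟨G * L ^ (e - 2 + e - (k + 1)), ?_, by simp [hmkL]⟩
        have := hpow hG (e - 2 + e - (k + 1))
        rwa [Nat.add_sub_cancel' hk] at this
      · obtain ⟨j, hj⟩ : ∃ j, k + 1 = j + (e - 1 + e) := ⟨k + 1 - (e - 1 + e), by omega⟩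
        have h1 : π G ∈ Ideal.span {π P, π Q} :=
          binary_high (by omega) (hπh hP) (hπh hQ) hp0 hpq j (hj ▸ hπh hG)
        obtain ⟨G', hG', h2⟩ := core_lift hP hQ hL hπι hker hG h1
        obtain ⟨G'', h3, h4⟩ := ih G' hG'
        refine ⟨G'', h3, ?_⟩
        have := (hmk _).2 (hPI h2)
        rw [map_sub, map_mul, hmkL, mul_one, sub_eq_zero] at this
        rw [h4, this]
  let mkD : homogeneousSubmodule (Fin 3) ℂ (e - 2 + e) →ₗ[ℂ] (MvPolynomial (Fin 3) ℂ ⧸ I) :=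
    mk.toLinearMap ∘ₗ (homogeneousSubmodule (Fin 3) ℂ (e - 2 + e)).subtype
  have hmkD : Function.Surjective mkD := by
    intro b
    obtain ⟨G, rfl⟩ := hmks b
    rw [← sum_homogeneousComponent G, map_sum]
    choose f hf1 hf2 using hall
    refine ⟨∑ i ∈ Finset.range (G.totalDegree + 1),
      ⟨f i (homogeneousComponent i G) (homogeneousComponent_isHomogeneous _ _), hf1 _ _ _⟩, ?_⟩
    rw [map_sum]
    exact Finset.sum_congr rfl fun i _ => hf2 _ _ _
  have : Module.Finite ℂ (MvPolynomial (Fin 3) ℂ ⧸ I) := Module.Finite.of_surjective mkD hmkD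
  -- the residue functional
  obtain ⟨τ, hτ⟩ := binary_socle_functional he (hπh hP) (hπh hQ) hp0 hpq
  let πD : homogeneousSubmodule (Fin 3) ℂ (e - 2 + e) →ₗ[ℂ]
      homogeneousSubmodule (Fin 2) ℂ (e - 2 + e) :=
    π.toLinearMap.restrict (fun x hx => hπh hx)
  have hcond : ∀ x, mkD x = 0 → (τ ∘ₗ πD) x = 0 := by
    intro x hx
    have h1 : x.1 ∈ Ideal.span {P, Q} := core_homog hP hQ hL hnzd x.2 ((hmk _).1 hx)
    refine (hτ _).2 ?_
    change π x.1 ∈ _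
    obtain ⟨a, b, hab⟩ := Ideal.mem_span_pair.1 h1
    rw [← hab, map_add, map_mul, map_mul]
    exact Ideal.mem_span_pair.2 ⟨_, _, rfl⟩
  obtain ⟨ρ, hρ⟩ := exists_factor mkD hmkD (τ ∘ₗ πD) hcond
  have hρ0 : ∀ {G : MvPolynomial (Fin 3) ℂ} (_ : G.IsHomogeneous (e - 2 + e)),
      ρ (mk G) = 0 ↔ π G ∈ Ideal.span {π P, π Q} := by
    intro G hG
    have := hρ ⟨G, hG⟩
    change ρ (mk G) = _ at this
    rw [this]
    exact hτ _
  -- non-degeneracy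
  have hnd : ∀ b : MvPolynomial (Fin 3) ℂ ⧸ I, b ≠ 0 → ∃ k j : ℕ, k + j = e - 2 + e ∧
      ∃ U V : MvPolynomial (Fin 3) ℂ, U.IsHomogeneous k ∧ V.IsHomogeneous j ∧ mk U = b ∧
        ρ (b * mk V) ≠ 0 := by
    intro b hb
    have hex : ∃ k, ∃ U : MvPolynomial (Fin 3) ℂ, U.IsHomogeneous k ∧ mk U = b := by
      obtain ⟨x, hx⟩ := hmkD b
      exact ⟨_, x.1, x.2, hx⟩
    classical
    have hle : Nat.find hex ≤ e - 2 + e := by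
      obtain ⟨x, hx⟩ := hmkD b
      exact Nat.find_min' hex ⟨x.1, x.2, hx⟩
    obtain ⟨U, hU, hUb⟩ := Nat.find_spec hex
    set k := Nat.find hex with hk
    have hnot : π U ∉ Ideal.span {π P, π Q} := by
      intro hmem
      rcases Nat.eq_zero_or_pos k with h0 | hpos
      · rw [h0] at hU
        have h1 : π U = 0 := mem_pair_homog_lt (hπh hP) (hπh hQ) (hπh hU) (by omega) hmem
        have h2 : U = 0 := dvd_homog_lt hL hU (by omega) (dvd_of_pi hker h1)
        exact hb (by rw [← hUb, h2, map_zero])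
      · obtain ⟨k', hk'⟩ : ∃ k', k = k' + 1 := ⟨k - 1, by omega⟩
        rw [hk'] at hU
        obtain ⟨G', hG', h2⟩ := core_lift hP hQ hL hπι hker hU hmem
        have := (hmk _).2 (hPI h2)
        rw [map_sub, map_mul, hmkL, mul_one, sub_eq_zero] at this
        exact Nat.find_min hex (m := k') (by omega) ⟨G', hG', by rw [← this, hUb]⟩
    obtain ⟨v, hv, hv'⟩ := binary_dual he (hπh hP) (hπh hQ) hp0 hpq (e - 2 + e - k)
      (by omega) (hπh hU) hnot
    refine ⟨k, e - 2 + e - k, by omega, U, ι v, hU, hιh hv, hUb, ?_⟩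
    have h3 : (U * ι v).IsHomogeneous (e - 2 + e) := by
      have := hU.mul (hιh hv)
      rwa [Nat.add_sub_cancel' hle] at this
    rw [← hUb, ← map_mul, Ne, hρ0 h3, map_mul, hπι]
    exact hv'
  let β : (MvPolynomial (Fin 3) ℂ ⧸ I) →ₗ[ℂ] Module.Dual ℂ (MvPolynomial (Fin 3) ℂ ⧸ I) :=
    (LinearMap.mul ℂ (MvPolynomial (Fin 3) ℂ ⧸ I)).compr₂ ρ
  have hβ : ∀ b c, β b c = ρ (b * c) := fun b c => rfl
  have hβinj : Function.Injective β := by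
    rw [← LinearMap.ker_eq_bot, LinearMap.ker_eq_bot']
    intro b hb
    by_contra hb0
    obtain ⟨k, j, _, U, V, _, _, _, h⟩ := hnd b hb0
    apply h
    rw [← hβ, hb]; rfl
  have hβsurj : Function.Surjective β :=
    (LinearMap.injective_iff_surjective_of_finrank_eq_finrank
      (Subspace.dual_finrank_eq).symm).1 hβinj
  -- the functional descends
  have hφI : ∀ x, mk.toLinearMap x = 0 → φ x = 0 := by
    intro x hx
    have hx' : x ∈ I := (hmk x).1 hx
    obtain ⟨y, hy, z, hz, rfl⟩ := Submodule.mem_sup.1 hx'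
    obtain ⟨a, b, rfl⟩ := Ideal.mem_span_pair.1 hy
    obtain ⟨c, rfl⟩ := Ideal.mem_span_singleton'.1 hz
    rw [mul_sub, mul_one, map_add, map_add, map_sub, hφP, hφQ, hφL]
    simp
  obtain ⟨ψ, hψ⟩ := exists_factor mk.toLinearMap hmks φ hφI
  have hψ' : ∀ G, ψ (mk G) = φ G := hψ
  obtain ⟨b, hb⟩ := hβsurj ψ
  have hb0 : b ≠ 0 := by
    rintro rfl
    rw [map_zero] at hb
    apply hφ
    refine LinearMap.ext fun G => ?_
    rw [← hψ', ← hb]; rfl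
  have hbρ : ∀ G, ρ (b * mk G) = φ G := by
    intro G; rw [← hψ', ← hb]; rfl
  obtain ⟨k, j, hkj, U, V, hU, hV, hUb, hUV⟩ := hnd b hb0
  have hk : k ≤ e - 1 := by
    by_contra hlt
    apply hUV
    rw [hbρ]
    have h1 := hφd (V * L ^ (e - 2 - j)) (by
      have := hpow hV (e - 2 - j)
      rwa [show j + (e - 2 - j) = e - 2 by omega] at this)
    rw [← h1, ← hψ', ← hψ']
    simp [hmkL]
  refine ⟨U * L ^ (e - 1 - k), ?_, ?_, ?_⟩
  · have := hpow hU (e - 1 - k)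
    rwa [Nat.add_sub_cancel' hk] at this
  · intro h
    apply hb0
    have := congrArg mk h
    simpa [hmkL, hUb] using this
  · refine core_homog hP hQ hL hnzd ((hpow hU (e - 1 - k)).mul hR) ((hmk _).1 ?_)
    have h1 : b * mk R = 0 := by
      by_contra hne
      obtain ⟨_, _, _, _, V', _, _, _, h⟩ := hnd _ hne
      apply h
      rw [mul_assoc, ← map_mul, hbρ, mul_comm]
      exact hφR _
    simpa [hmkL, hUb] using h1

end partC

section partD

lemma no_common_factor {d : ℕ} (hd : 1 ≤ d) {F : MvPolynomial (Fin 3) ℂ} (hF : F.IsHomogeneous d)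
    (hirr : Irreducible F) {g : MvPolynomial (Fin 3) ℂ} (hg : Irreducible g)
    (h : ∀ i, g ∣ pderiv i F) : False := by
  have heul := hF.sum_X_mul_pderiv
  have hgF : g ∣ F := by
    have h1 : g ∣ d • F := by
      rw [← heul]
      exact Finset.dvd_sum fun i _ => Dvd.dvd.mul_left (h i) _
    have hd0 : (d : ℂ) ≠ 0 := by exact_mod_cast (by omega : d ≠ 0)
    have : F = C ((d : ℂ)⁻¹) * (d • F) := by
      rw [nsmul_eq_mul, ← mul_assoc, ← map_natCast (C : ℂ →+* MvPolynomial (Fin 3) ℂ), ← C_mul,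
        inv_mul_cancel₀ hd0]; simp
    rw [this]
    exact Dvd.dvd.mul_left h1 _
  have hFg : F ∣ g := (hg.associated_of_dvd hirr hgF).symm.dvd
  have hz : ∀ i, pderiv i F = 0 := fun i =>
    dvd_homog_lt hF hF.pderiv (by omega) (hFg.trans (h i))
  have : d • F = 0 := by rw [← heul]; simp [hz]
  have hF0 : F = 0 := by
    rcases smul_eq_zero.1 this with h | h
    · omega
    · exact h
  exact hirr.ne_zero hF0

lemma exists_t {P U V : MvPolynomial (Fin 3) ℂ} (hP : P ≠ 0)
    (h : ∀ g, Irreducible g → g ∣ P → g ∣ U → g ∣ V → False) :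
    ∃ t : ℂ, IsRelPrime P (U + C t * V) := by
  classical
  let s := (UniqueFactorizationMonoid.factors P).toFinset
  let bad : Set ℂ := ⋃ g ∈ s, {t | g ∣ U + C t * V}
  have hbad : bad.Finite := by
    refine Set.Finite.biUnion s.finite_toSet fun g hg => Set.Subsingleton.finite ?_
    intro t ht t' ht'
    by_contra hne
    have hg' : g ∈ UniqueFactorizationMonoid.factors P := by simpa [s] using hg
    have hgV : g ∣ V := by
      have h1 : g ∣ C (t - t') * V := by
        have := dvd_sub ht ht'
        convert this using 1
        rw [C_sub]; ring
      have h2 : V = C ((t - t')⁻¹) * (C (t - t') * V) := by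
        rw [← mul_assoc, ← C_mul, inv_mul_cancel₀ (sub_ne_zero.2 hne)]; simp
      rw [h2]; exact Dvd.dvd.mul_left h1 _
    refine h g (UniqueFactorizationMonoid.irreducible_of_factor g hg')
      (UniqueFactorizationMonoid.dvd_of_mem_factors hg') ?_ hgV
    exact (dvd_add_left (Dvd.dvd.mul_left hgV _)).1 ht
  obtain ⟨t, ht⟩ := hbad.exists_notMem
  refine ⟨t, (UniqueFactorizationMonoid.isRelPrime_iff_no_prime_factors hP).2 ?_⟩
  intro g hg hg2 hp
  apply ht
  obtain ⟨q, hq, hgq⟩ := UniqueFactorizationMonoid.exists_mem_factors_of_dvd hP hp.irreducible hg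
  simp only [bad, Set.mem_iUnion]
  refine ⟨q, by simpa [s] using hq, ?_⟩
  exact hgq.symm.dvd.trans hg2

lemma fin3_cases : ∀ i j : Fin 3, j = i ∨ j = i+1 ∨ j = i+2 := by decide

lemma exists_PQ {d : ℕ} (hd : 1 ≤ d) {F : MvPolynomial (Fin 3) ℂ} (hF : F.IsHomogeneous d)
    (hirr : Irreducible F) :
    ∃ (i : Fin 3) (t : ℂ), pderiv i F ≠ 0 ∧
      IsRelPrime (pderiv i F) (pderiv (i+1) F + C t * pderiv (i+2) F) := by
  have : ∃ i, pderiv i F ≠ 0 := by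
    by_contra! hcon
    exact no_common_factor hd hF hirr hirr (fun i => by rw [hcon i]; exact dvd_zero _)
  obtain ⟨i, hi⟩ := this
  obtain ⟨t, ht⟩ := exists_t (P := pderiv i F) (U := pderiv (i+1) F) (V := pderiv (i+2) F) hi
    (by
      intro g hg h0 h1 h2
      refine no_common_factor hd hF hirr hg fun j => ?_
      have : j = i ∨ j = i+1 ∨ j = i+2 := fin3_cases i j
      rcases this with h | h | h
      · rw [h]; exact h0
      · rw [h]; exact h1
      · rw [h]; exact h2)
  exact ⟨i, t, hi, ht⟩

end partD

section partE

/-- The substitution `X₂ ↦ s X₀ + t X₁`. -/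
def ppi (s t : ℂ) : MvPolynomial (Fin 3) ℂ →ₐ[ℂ] MvPolynomial (Fin 2) ℂ :=
  aeval ![X 0, X 1, C s * X 0 + C t * X 1]

/-- The inclusion of binary forms. -/
def pio : MvPolynomial (Fin 2) ℂ →ₐ[ℂ] MvPolynomial (Fin 3) ℂ := aeval ![X 0, X 1]

/-- The linear form. -/
def pL (s t : ℂ) : MvPolynomial (Fin 3) ℂ := X 2 - C s * X 0 - C t * X 1

lemma pL_homog (s t : ℂ) : (pL s t).IsHomogeneous 1 := by
  unfold pL
  refine ((isHomogeneous_X _ _).sub ?_).sub ?_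
  · simpa using (isHomogeneous_C _ s).mul (isHomogeneous_X ℂ (0 : Fin 3))
  · simpa using (isHomogeneous_C _ t).mul (isHomogeneous_X ℂ (1 : Fin 3))

lemma pL_ne (s t : ℂ) : pL s t ≠ 0 := by
  intro h
  have := congrArg (eval ![0,0,1]) h
  simp [pL] at this

lemma ppi_pio (s t : ℂ) (u) : ppi s t (pio u) = u := by
  have : (ppi s t).comp pio = AlgHom.id ℂ _ := by
    ext i
    fin_cases i <;> simp [ppi, pio]
  exact DFunLike.congr_fun this u

lemma ppi_pL (s t : ℂ) : ppi s t (pL s t) = 0 := by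
  simp [ppi, pL, algebraMap_eq]

lemma pL_dvd (s t : ℂ) (G) : pL s t ∣ G - pio (ppi s t G) := by
  induction G using MvPolynomial.induction_on with
  | C a => simp [algHom_C, algebraMap_eq]
  | add p q hp hq =>
    have := dvd_add hp hq
    rw [map_add, map_add]
    convert this using 1; ring
  | mul_X p i hp =>
    have hX : pL s t ∣ X i - pio (ppi s t (X i)) := by
      fin_cases i
      · simp [ppi, pio]
      · simp [ppi, pio]
      · simp only [ppi, pio, pL]
        simp [sub_sub]
    rw [map_mul, map_mul]
    have : p * X i - pio (ppi s t p) * pio (ppi s t (X i)) =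
      (p - pio (ppi s t p)) * X i + pio (ppi s t p) * (X i - pio (ppi s t (X i))) := by ring
    rw [this]
    exact dvd_add (Dvd.dvd.mul_right hp _) (Dvd.dvd.mul_left hX _)

lemma ppi_homog (s t : ℂ) {k : ℕ} {G} (h : G.IsHomogeneous k) : (ppi s t G).IsHomogeneous k := by
  have := h.aeval (n := 1) (![X 0, X 1, C s * X 0 + C t * X 1] : Fin 3 → MvPolynomial (Fin 2) ℂ)
      (fun i => by
    fin_cases i
    · exact isHomogeneous_X ℂ (0 : Fin 2)
    · exact isHomogeneous_X ℂ (1 : Fin 2)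
    · show (C s * X 0 + C t * X 1 : MvPolynomial (Fin 2) ℂ).IsHomogeneous 1
      refine IsHomogeneous.add (R := ℂ) (σ := Fin 2) ?_ ?_
      · simpa using (isHomogeneous_C _ s).mul (isHomogeneous_X ℂ (0 : Fin 2))
      · simpa using (isHomogeneous_C _ t).mul (isHomogeneous_X ℂ (1 : Fin 2)))
  rw [one_mul] at this
  exact this

lemma pio_homog {k : ℕ} {G} (h : G.IsHomogeneous k) : (pio G).IsHomogeneous k := by
  have := h.aeval (n := 1) (![X 0, X 1] : Fin 2 → MvPolynomial (Fin 3) ℂ) (fun i => by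
    fin_cases i
    · exact isHomogeneous_X ℂ (0 : Fin 3)
    · exact isHomogeneous_X ℂ (1 : Fin 3))
  rw [one_mul] at this
  exact this

lemma eval_ppi (s t : ℂ) (v : Fin 3 → ℂ) (hv : eval v (pL s t) = 0) (G) :
    eval ![v 0, v 1] (ppi s t G) = eval v G := by
  have h2 : v 2 = s * v 0 + t * v 1 := by
    simp [pL] at hv; linear_combination hv
  have : (aeval ![v 0, v 1]).comp (ppi s t) = (aeval v : MvPolynomial (Fin 3) ℂ →ₐ[ℂ] ℂ) := by
    ext i
    fin_cases i <;> simp [ppi, h2]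
  have := DFunLike.congr_fun this G
  simpa [aeval_eq_eval] using this

/-- Avoiding finitely many primes. -/
lemma exists_st (T : Set (Ideal (MvPolynomial (Fin 3) ℂ))) (hT : T.Finite) :
    ∃ s t : ℂ, ∀ p ∈ T, pL s t ∈ p → ∀ i, X i ∈ p := by
  classical
  let lin : (Fin 3 → ℂ) →ₗ[ℂ] MvPolynomial (Fin 3) ℂ :=
    Fintype.linearCombination ℂ (fun i => (X i : MvPolynomial (Fin 3) ℂ))
  let f : Ideal (MvPolynomial (Fin 3) ℂ) → Subspace ℂ (Fin 3 → ℂ) := fun p =>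
    (p.restrictScalars ℂ).comap lin
  let W : Subspace ℂ (Fin 3 → ℂ) := LinearMap.ker (LinearMap.proj 2)
  let s : Finset (Subspace ℂ (Fin 3 → ℂ)) := insert W ((hT.toFinset.image f).erase ⊤)
  have hs : ⊤ ∉ s := by
    intro h
    rcases Finset.mem_insert.1 h with h | h
    · have : (Pi.single 2 1 : Fin 3 → ℂ) ∈ W := by rw [← h]; trivial
      simp [W] at this
    · simp at h
  have := Subspace.biUnion_ne_univ_of_top_notMem hs
  obtain ⟨v, hv⟩ := (Set.ne_univ_iff_exists_notMem _).1 this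
  simp only [Set.mem_iUnion, not_exists] at hv
  have hv2 : v 2 ≠ 0 := by
    intro h
    exact hv W (Finset.mem_insert_self _ _) (by simpa [W] using h)
  refine ⟨-(v 0 / v 2), -(v 1 / v 2), fun p hp hL => ?_⟩
  have hlin : lin v = C (v 2) * pL (-(v 0 / v 2)) (-(v 1 / v 2)) := by
    have h0 : v 0 = v 2 * (v 0 / v 2) := by field_simp
    have h1 : v 1 = v 2 * (v 1 / v 2) := by field_simp
    simp only [lin, Fintype.linearCombination_apply, Fin.sum_univ_three, pL, smul_eq_C_mul]
    conv_lhs => rw [h0, h1]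
    simp only [C_mul, C_neg]
    ring
  have hmem : v ∈ f p := by
    show lin v ∈ p
    rw [hlin]; exact p.mul_mem_left _ hL
  have htop : f p = ⊤ := by
    by_contra hne
    refine hv (f p) ?_ hmem
    simp only [s, Finset.mem_insert, Finset.mem_erase, Finset.mem_image]
    exact Or.inr ⟨hne, p, by simpa using hp, rfl⟩
  intro i
  have : (Pi.single i 1 : Fin 3 → ℂ) ∈ f p := by rw [htop]; trivial
  have h2 : lin (Pi.single i 1) ∈ p := this
  simpa [lin] using h2

lemma exists_L {P Q : MvPolynomial (Fin 3) ℂ} (hP0 : P ≠ 0) (hPQ : IsRelPrime P Q) :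
    ∃ s t : ℂ, ∀ g : MvPolynomial (Fin 2) ℂ, Prime g → g ∣ ppi s t P → g ∣ ppi s t Q → False := by
  classical
  obtain ⟨s, t, hst⟩ := exists_st (Ideal.span {P, Q}).minimalPrimes
    (Ideal.finite_minimalPrimes_of_isNoetherianRing _ _)
  refine ⟨s, t, fun g hg hgP hgQ => ?_⟩
  let q : Ideal (MvPolynomial (Fin 3) ℂ) := (Ideal.span {g}).comap (ppi s t).toRingHom
  have hmemq : ∀ G, G ∈ q ↔ g ∣ ppi s t G := fun G => by
    simp [q, Ideal.mem_comap, Ideal.mem_span_singleton]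
  have : (Ideal.span {g}).IsPrime := (Ideal.span_singleton_prime hg.ne_zero).2 hg
  have hqp : q.IsPrime := Ideal.IsPrime.comap _
  have hq : q = Ideal.span {pio g, pL s t} := by
    apply le_antisymm
    · intro G hG
      obtain ⟨u, hu⟩ := (hmemq G).1 hG
      obtain ⟨w, hw⟩ := pL_dvd s t G
      rw [Ideal.mem_span_pair]
      refine ⟨pio u, w, ?_⟩
      rw [hu, map_mul] at hw
      linear_combination -hw
    · rw [Ideal.span_le]
      rintro x (rfl | rfl)
      · exact (hmemq _).2 (by rw [ppi_pio])
      · exact (hmemq _).2 (by rw [ppi_pL]; exact dvd_zero _)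
  have hqh : q.height ≤ 2 := by
    refine (Ideal.height_le_card_of_mem_minimalPrimes_span_finset
      (s := {pio g, pL s t}) ?_).trans ?_
    · rw [Finset.coe_pair, ← hq, Ideal.minimalPrimes_eq_subsingleton_self]
      exact Set.mem_singleton _
    · exact_mod_cast Finset.card_le_two
  have hle : Ideal.span {P, Q} ≤ q := by
    rw [Ideal.span_le]
    rintro x (rfl | rfl)
    · exact (hmemq _).2 hgP
    · exact (hmemq _).2 hgQ
  obtain ⟨p, hp, hpq⟩ := Ideal.exists_minimalPrimes_le hle
  have hpp : p.IsPrime := hp.1.1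
  have hLp : pL s t ∉ p := by
    intro hL
    have hX := hst p hp hL
    have h0 : g ∣ X 0 := by simpa [ppi] using (hmemq _).1 (hpq (hX 0))
    have h1 : g ∣ X 1 := by simpa [ppi] using (hmemq _).1 (hpq (hX 1))
    have hass : Associated g (X 0) := hg.irreducible.associated_of_dvd (X_prime (R := ℂ) (i := (0 : Fin 2))).irreducible h0
    obtain ⟨w, hw⟩ := hass.symm.dvd.trans h1
    have := congrArg (eval ![0, 1]) hw
    simp at this
  have hlt : p < q := lt_of_le_of_ne hpq (by
    rintro rfl
    exact hLp ((hmemq _).2 (by rw [ppi_pL]; exact dvd_zero _)))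
  have hph : p.height ≤ 1 := by
    have h1 := (Ideal.height_add_one_le_of_lt_of_isPrime hlt).trans hqh
    have : p.height + 1 ≤ 1 + 1 := by simpa [one_add_one_eq_two] using h1
    exact (ENat.add_le_add_iff_right (by simp)).1 this
  have hPp : P ∈ p := hp.1.2 (Ideal.subset_span (by simp))
  have hQp : Q ∈ p := hp.1.2 (Ideal.subset_span (by simp))
  obtain ⟨w, hwp, hw⟩ := Ideal.IsPrime.exists_mem_prime_of_ne_bot (I := p) hpp
    (fun h => hP0 (by rw [h] at hPp; simpa using hPp))
  have : (Ideal.span {w}).IsPrime := (Ideal.span_singleton_prime hw.ne_zero).2 hw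
  have hwle : Ideal.span {w} ≤ p := by rw [Ideal.span_le]; simpa using hwp
  have hpw : p = Ideal.span {w} := by
    by_contra hne
    have hlt2 : Ideal.span {w} < p := lt_of_le_of_ne hwle (Ne.symm hne)
    have hb : (⊥ : Ideal (MvPolynomial (Fin 3) ℂ)) < Ideal.span {w} := by
      rw [bot_lt_iff_ne_bot]; simpa using hw.ne_zero
    have h1 := Ideal.height_add_one_le_of_lt_of_isPrime hlt2
    have h2 := Ideal.height_add_one_le_of_lt_of_isPrime hb
    have h3 : (1 : ℕ∞) ≤ (Ideal.span {w}).height := le_trans (by simp) h2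
    have h4 : (1 : ℕ∞) + 1 ≤ 1 := (add_le_add_left h3 1).trans (h1.trans hph)
    exact absurd h4 (by decide)
  rw [hpw, Ideal.mem_span_singleton] at hPp hQp
  exact hw.not_isUnit (hPQ hPp hQp)

lemma exists_L' {e : ℕ} (he : 1 ≤ e) {P Q : MvPolynomial (Fin 3) ℂ} (hP : P.IsHomogeneous e)
    (hQ : Q.IsHomogeneous e) (hP0 : P ≠ 0) (hPQ : IsRelPrime P Q) :
    ∃ s t : ℂ, ppi s t P ≠ 0 ∧ IsRelPrime (ppi s t P) (ppi s t Q) ∧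
      ∀ v : Fin 3 → ℂ, v ≠ 0 → eval v P = 0 → eval v Q = 0 → eval v (pL s t) ≠ 0 := by
  obtain ⟨s, t, h⟩ := exists_L hP0 hPQ
  have hp0 : ppi s t P ≠ 0 := by
    intro h0
    by_cases hu : ppi s t Q = 0
    · exact h (X 0) X_prime (by simp [h0]) (by simp [hu])
    · have hnu : ¬ IsUnit (ppi s t Q) := by
        intro hunit
        have := (ppi_homog s t hQ)
        obtain ⟨c, hc, hcq⟩ := MvPolynomial.isUnit_iff_eq_C_of_isReduced.1 hunit
        have h2 := this.totalDegree hu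
        rw [hcq, totalDegree_C] at h2
        omega
      obtain ⟨g, hg, hgd⟩ := WfDvdMonoid.exists_irreducible_factor hnu hu
      exact h g hg.prime (by simp [h0]) hgd
  have hrel : IsRelPrime (ppi s t P) (ppi s t Q) :=
    (UniqueFactorizationMonoid.isRelPrime_iff_no_prime_factors hp0).2
      fun {g} hg hg2 hp => h g hp hg hg2
  refine ⟨s, t, hp0, hrel, fun v hv hvP hvQ hvL => hv ?_⟩
  have key : ∀ i : Fin 2, (![v 0, v 1] : Fin 2 → ℂ) i = 0 := by
    intro i
    have := binary_top he (ppi_homog s t hP) (ppi_homog s t hQ) hp0 hrel (u := X i ^ (e-1+e))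
      (by simpa using (isHomogeneous_X ℂ i).pow (e-1+e))
    obtain ⟨a, b, hab⟩ := Ideal.mem_span_pair.1 this
    have h3 := congrArg (eval ![v 0, v 1]) hab
    simp only [map_add, map_mul, eval_ppi s t v hvL, hvP, hvQ, map_pow, eval_X] at h3
    simp only [mul_zero, add_zero] at h3
    exact pow_eq_zero_iff (by omega) |>.1 h3.symm
  have h0 : v 0 = 0 := key 0
  have h1 : v 1 = 0 := key 1
  have h2 : v 2 = 0 := by simpa [pL, h0, h1] using hvL
  ext i; fin_cases i <;> simp [h0, h1, h2]

end partE

section partF1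

/-- Singular vectors. -/
def Sg (F : MvPolynomial (Fin 3) ℂ) (v : Fin 3 → ℂ) : Prop :=
  v ≠ 0 ∧ ∀ i, eval v (pderiv i F) = 0

/-- Hessian. -/
def Hs (F : MvPolynomial (Fin 3) ℂ) (v : Fin 3 → ℂ) : Matrix (Fin 3) (Fin 3) ℂ :=
  Matrix.of fun i j : Fin 3 => eval v (pderiv i (pderiv j F))

lemma pderiv_swap (i j : Fin 3) (F : MvPolynomial (Fin 3) ℂ) :
    pderiv i (pderiv j F) = pderiv j (pderiv i F) := by
  have : ⁅(pderiv i : Derivation ℂ (MvPolynomial (Fin 3) ℂ) (MvPolynomial (Fin 3) ℂ)),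
      (pderiv j : Derivation ℂ (MvPolynomial (Fin 3) ℂ) (MvPolynomial (Fin 3) ℂ))⁆ = 0 := by
    apply MvPolynomial.derivation_ext
    intro k
    rw [Derivation.commutator_apply]
    simp only [pderiv_X, Pi.single_apply]
    split_ifs <;> simp
  have h := DFunLike.congr_fun this F
  rw [Derivation.commutator_apply] at h
  exact sub_eq_zero.1 h

lemma hess_mulVec {d : ℕ} {F : MvPolynomial (Fin 3) ℂ} (hF : F.IsHomogeneous d) {v : Fin 3 → ℂ}
    (hv : Sg F v) : (Hs F v).mulVec v = 0 := by
  ext i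
  have h := (hF.pderiv (i := i)).sum_X_mul_pderiv
  have h2 := congrArg (eval v) h
  simp only [map_sum, map_mul, eval_X, map_nsmul, hv.2 i] at h2
  simp only [Matrix.mulVec, dotProduct, Hs, Matrix.of_apply, Pi.zero_apply]
  rw [← smul_zero (d-1), ← h2]
  refine Finset.sum_congr rfl fun j _ => ?_
  rw [pderiv_swap i j, mul_comm]

lemma hess_ker {M : Matrix (Fin 3) (Fin 3) ℂ} (hM : M.rank = 2) {v : Fin 3 → ℂ} (hv : v ≠ 0)
    (h : M.mulVec v = 0) {a : Fin 3 → ℂ} (ha : M.mulVec a = 0) : ∃ c : ℂ, a = c • v := by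
  have hrk : Module.finrank ℂ (LinearMap.ker M.mulVecLin) = 1 := by
    have := LinearMap.finrank_range_add_finrank_ker M.mulVecLin
    rw [← Matrix.rank, hM] at this
    simp at this; omega
  obtain ⟨c, hc⟩ := (finrank_eq_one_iff_of_nonzero' (⟨v, by simpa using h⟩ : LinearMap.ker M.mulVecLin)
    (by simpa [Subtype.ext_iff] using hv)).1 hrk ⟨a, by simpa using ha⟩
  exact ⟨c, by simpa [Subtype.ext_iff] using hc.symm⟩

lemma hess_range {M : Matrix (Fin 3) (Fin 3) ℂ} (hM : M.rank = 2) {v : Fin 3 → ℂ} (hv : v ≠ 0)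
    (h : Matrix.vecMul v M = 0) {w : Fin 3 → ℂ} (hw : v ⬝ᵥ w = 0) : ∃ c, M.mulVec c = w := by
  let f : (Fin 3 → ℂ) →ₗ[ℂ] ℂ := dotProductBilin ℂ ℂ v
  have hf : ∀ w, f w = v ⬝ᵥ w := fun w => rfl
  have hle : LinearMap.range M.mulVecLin ≤ LinearMap.ker f := by
    rintro _ ⟨c, rfl⟩
    rw [LinearMap.mem_ker, hf, Matrix.mulVecLin_apply, Matrix.dotProduct_mulVec, h]
    simp
  have hsurj : LinearMap.range f = ⊤ := by
    apply LinearMap.range_eq_top.2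
    apply LinearMap.surjective
    intro h0
    apply hv
    ext i
    have := DFunLike.congr_fun h0 (Pi.single i 1)
    simpa [hf] using this
  have hk : Module.finrank ℂ (LinearMap.ker f) = 2 := by
    have := LinearMap.finrank_range_add_finrank_ker f
    rw [hsurj] at this
    simp at this; omega
  have := Submodule.eq_of_le_of_finrank_eq hle (by rw [hk, ← hM]; rfl)
  have hmem : w ∈ LinearMap.range M.mulVecLin := by rw [this]; exact hw
  obtain ⟨c, hc⟩ := hmem
  exact ⟨c, hc⟩

/-- linear forms through `v` -/
def lf (u : Fin 3 → ℂ) (i0 : Fin 3) (j : Fin 3) : MvPolynomial (Fin 3) ℂ := X j - C (u j) * X i0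

/-- ideal of the line through `v` -/
def Pq (u : Fin 3 → ℂ) (i0 : Fin 3) : Ideal (MvPolynomial (Fin 3) ℂ) :=
  Ideal.span (Set.range (lf u i0))

lemma mem_Pq {k : ℕ} {G : MvPolynomial (Fin 3) ℂ} (hG : G.IsHomogeneous k) {v : Fin 3 → ℂ} {i0 : Fin 3}
    (hi0 : v i0 ≠ 0) (h : eval v G = 0) : G ∈ Pq (fun j => v j / v i0) i0 := by
  set u : Fin 3 → ℂ := fun j => v j / v i0 with hu
  let τ : MvPolynomial (Fin 3) ℂ →ₐ[ℂ] MvPolynomial (Fin 3) ℂ := aeval (fun j => C (u j) * X i0)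
  have key : ∀ G, G - τ G ∈ Pq u i0 := by
    intro G
    induction G using MvPolynomial.induction_on with
    | C a => simp [τ, algHom_C, algebraMap_eq]
    | add p q hp hq =>
      have := Ideal.add_mem _ hp hq
      rw [map_add]
      convert this using 1; ring
    | mul_X p i hp =>
      have hX : X i - τ (X i) ∈ Pq u i0 := by
        refine Ideal.subset_span ⟨i, ?_⟩
        simp [lf, τ]
      rw [map_mul]
      have : p * X i - τ p * τ (X i) = X i * (p - τ p) + τ p * (X i - τ (X i)) := by ring
      rw [this]
      exact Ideal.add_mem _ (Ideal.mul_mem_left _ _ hp) (Ideal.mul_mem_left _ _ hX)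
  have h0 : τ G = 0 := by
    have h1 : τ G = aeval (fun j => (C (v i0)⁻¹ * X i0) * C (v j)) G := by
      simp only [τ]
      congr 2
      ext1 j
      simp only [hu, div_eq_mul_inv, C_mul]; ring
    rw [h1, eval_smul_homog hG]
    have h2 : aeval (fun i => (C (v i) : MvPolynomial (Fin 3) ℂ)) G = C (eval v G) := by
      rw [← aeval_eq_eval]
      have := MvPolynomial.aeval_algebraMap_apply (B := MvPolynomial (Fin 3) ℂ) v G
      rw [algebraMap_eq] at this
      exact this
    rw [h2, h]; simp
  have := key G
  rwa [h0, sub_zero] at this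

lemma local_jac {d : ℕ} {F : MvPolynomial (Fin 3) ℂ} (hF : F.IsHomogeneous d) {v : Fin 3 → ℂ}
    (hv : Sg F v) (hH : (Hs F v).rank = 2) {k : ℕ} {G : MvPolynomial (Fin 3) ℂ}
    (hG : G.IsHomogeneous k) (h : eval v G = 0) : ∃ s, eval v s ≠ 0 ∧ s * G ∈ Jac F := by
  obtain ⟨i0, hi0⟩ : ∃ i0, v i0 ≠ 0 := by
    by_contra! hc; exact hv.1 (funext hc)
  set u : Fin 3 → ℂ := fun j => v j / v i0 with hu
  have hui : u i0 = 1 := by simp [hu, hi0]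
  have hl0 : lf u i0 i0 = 0 := by simp [lf, hui]
  have hlv : ∀ m, eval v (lf u i0 m) = 0 := by
    intro m; simp [lf, hu]; field_simp; simp
  let mq : Ideal (MvPolynomial (Fin 3) ℂ) := RingHom.ker (eval v)
  have hFj : ∀ j, pderiv j F - ∑ i, C (Hs F v i j) * lf u i0 i ∈ mq * Pq u i0 := by
    intro j
    have hm := mem_Pq (hF.pderiv (i := j)) hi0 (hv.2 j)
    obtain ⟨g, hg⟩ := (Ideal.mem_span_range_iff_exists_fun).1 hm
    have hgi : ∀ i, i ≠ i0 → Hs F v i j = eval v (g i) := by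
      intro i hi
      have h1 := congrArg (fun p => eval v (pderiv i p)) hg
      simp only [map_sum, Derivation.leibniz, map_add, smul_eq_mul, map_mul] at h1
      rw [← hu] at h1
      simp only [hlv, zero_mul, add_zero] at h1
      simp only [Hs, Matrix.of_apply, ← h1]
      rw [Finset.sum_eq_single i]
      · simp [lf, pderiv_X, hi, Pi.single_apply]
      · intro b _ hb
        simp [lf, pderiv_X, hi, hb, Pi.single_apply]
      · simp
    have : pderiv j F - ∑ i, C (Hs F v i j) * lf u i0 i = ∑ i, (g i - C (eval v (g i))) * lf u i0 i := by
      rw [← hg, ← Finset.sum_sub_distrib]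
      refine Finset.sum_congr rfl fun i _ => ?_
      by_cases hi : i = i0
      · rw [hi, ← hu, hl0]; simp
      · rw [hgi i hi, ← hu]; ring
    rw [this]
    refine Ideal.sum_mem _ fun i _ => Ideal.mul_mem_mul ?_ (Ideal.subset_span ⟨i, rfl⟩)
    simp [mq, RingHom.mem_ker]
  have hle : Pq u i0 ≤ Jac F ⊔ mq • Pq u i0 := by
    conv_lhs => unfold Pq
    rw [Ideal.span_le]
    rintro _ ⟨m, rfl⟩
    have hvm : Matrix.vecMul v (Hs F v) = 0 := by
      have h1 := hess_mulVec hF hv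
      rw [← h1]
      ext i
      simp only [Matrix.vecMul, Matrix.mulVec, dotProduct, Hs, Matrix.of_apply]
      refine Finset.sum_congr rfl fun j _ => ?_
      rw [pderiv_swap i j, mul_comm]
    obtain ⟨c, hc⟩ := hess_range hH hv.1 hvm (w := Pi.single m 1 - u m • Pi.single i0 1) (by
      simp [dotProduct_sub, hu]; field_simp; simp)
    have hsum : lf u i0 m = ∑ j, C (c j) * pderiv j F -
        ∑ j, C (c j) * (pderiv j F - ∑ i, C (Hs F v i j) * lf u i0 i) := by
      rw [← Finset.sum_sub_distrib]
      have : ∀ j, C (c j) * pderiv j F - C (c j) * (pderiv j F - ∑ i, C (Hs F v i j) * lf u i0 i) =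
          ∑ i, C (c j) * (C (Hs F v i j) * lf u i0 i) := by
        intro j; rw [← Finset.mul_sum]; ring
      rw [Finset.sum_congr rfl fun j _ => this j, Finset.sum_comm]
      have h2 : ∀ i, ∑ j, C (c j) * (C (Hs F v i j) * lf u i0 i) =
          C ((Hs F v).mulVec c i) * lf u i0 i := by
        intro i
        simp only [Matrix.mulVec, dotProduct, map_sum, Finset.sum_mul, C_mul]
        exact Finset.sum_congr rfl fun j _ => by ring
      rw [Finset.sum_congr rfl fun i _ => h2 i, hc]
      simp only [Pi.sub_apply, Pi.smul_apply, C_sub, sub_mul, Finset.sum_sub_distrib, smul_eq_mul,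
        C_mul, Pi.single_apply]
      simp [hl0]
    show lf u i0 m ∈ Jac F ⊔ mq • Pq u i0
    rw [hsum]
    refine Ideal.sub_mem _ (Ideal.mem_sup_left ?_) (Ideal.mem_sup_right ?_)
    · exact Ideal.sum_mem _ fun j _ => Ideal.mul_mem_left _ _ (Ideal.subset_span ⟨j, rfl⟩)
    · exact Ideal.sum_mem _ fun j _ => Ideal.mul_mem_left _ _ (hFj j)
  obtain ⟨r, hr, hrP⟩ := Submodule.exists_sub_one_mem_and_smul_le_of_fg_of_le_sup
    (IsNoetherian.noetherian (Pq u i0)) le_rfl hle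
  refine ⟨r, ?_, ?_⟩
  · have : eval v (r - 1) = 0 := hr
    rw [map_sub, map_one] at this
    rw [sub_eq_zero.1 this]; exact one_ne_zero
  · exact hrP (Submodule.smul_mem_pointwise_smul _ _ _ (mem_Pq hG hi0 h))

/-- `k`-forms vanishing at all singular vectors -/
def Vz (F : MvPolynomial (Fin 3) ℂ) (k : ℕ) (G : MvPolynomial (Fin 3) ℂ) : Prop :=
  G.IsHomogeneous k ∧ ∀ v, Sg F v → eval v G = 0

lemma pow_vars_mul {d : ℕ} {F : MvPolynomial (Fin 3) ℂ} (hF : F.IsHomogeneous d)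
    (hN : ∀ v, Sg F v → (Hs F v).rank = 2) {k : ℕ} {G : MvPolynomial (Fin 3) ℂ} (hG : Vz F k G) :
    ∃ N, ∀ n, N ≤ n → ∀ m ∈ idealOfVars (Fin 3) ℂ ^ n, m * G ∈ Jac F := by
  let Q : Ideal (MvPolynomial (Fin 3) ℂ) := Submodule.comap (LinearMap.toSpanSingleton (MvPolynomial (Fin 3) ℂ) _ G) (Jac F)
  have hQ : ∀ s, s ∈ Q ↔ s * G ∈ Jac F := fun s => by
    simp [Q, LinearMap.toSpanSingleton_apply]
  have hrad : idealOfVars (Fin 3) ℂ ≤ Q.radical := by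
    rw [← vanishingIdeal_zeroLocus_eq_radical (K := ℂ) Q]
    unfold idealOfVars
    rw [Ideal.span_le]
    rintro _ ⟨i, rfl⟩
    intro x hx
    suffices x = 0 by simp [this]
    by_contra hx0
    by_cases hs : Sg F x
    · obtain ⟨s, hs0, hsG⟩ := local_jac hF hs (hN x hs) hG.1 (hG.2 x hs)
      exact hs0 (by simpa [aeval_eq_eval] using hx s ((hQ s).2 hsG))
    · have : ∃ i, eval x (pderiv i F) ≠ 0 := by
        by_contra! hc; exact hs ⟨hx0, hc⟩
      obtain ⟨i, hi⟩ := this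
      exact hi (by simpa [aeval_eq_eval] using hx (pderiv i F) ((hQ _).2
        (Ideal.mul_mem_right _ _ (Ideal.subset_span ⟨i, rfl⟩))))
  obtain ⟨N, hN⟩ := Ideal.exists_pow_le_of_le_radical_of_fg hrad (IsNoetherian.noetherian _)
  exact ⟨N, fun n hn m hm => (hQ m).1 (hN (Ideal.pow_le_pow_right hn hm))⟩

lemma Vz_le_jac {d : ℕ} {F : MvPolynomial (Fin 3) ℂ} (hF : F.IsHomogeneous d)
    (hN : ∀ v, Sg F v → (Hs F v).rank = 2) :
    ∃ K, ∀ k, K ≤ k → ∀ G, Vz F k G → G ∈ Jac F := by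
  classical
  obtain ⟨T, hT, hspan⟩ := (Submodule.fg_span_iff_fg_span_finset_subset
    (R := MvPolynomial (Fin 3) ℂ) {G | ∃ k, Vz F k G}).1 (IsNoetherian.noetherian _)
  have hT' : ∀ g : T, ∃ k N : ℕ, Vz F k g.1 ∧
      ∀ n, N ≤ n → ∀ m ∈ idealOfVars (Fin 3) ℂ ^ n, m * g.1 ∈ Jac F := by
    intro g
    obtain ⟨k, hk⟩ := hT g.2
    obtain ⟨N, hN⟩ := pow_vars_mul hF hN hk
    exact ⟨k, N, hk, hN⟩
  choose κ ν hκ hν using hT'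
  refine ⟨∑ g, (κ g + ν g), fun k hk G hG => ?_⟩
  have hmem : G ∈ Submodule.span (MvPolynomial (Fin 3) ℂ) (T : Set _) := by
    rw [← hspan]; exact Submodule.subset_span ⟨k, hG⟩
  have : (T : Set (MvPolynomial (Fin 3) ℂ)) = Set.range (fun g : T => g.1) := by simp
  rw [this] at hmem
  obtain ⟨c, hc⟩ := (Submodule.mem_span_range_iff_exists_fun _).1 hmem
  have hGk : G = homogeneousComponent k G := (homogeneousComponent_of_mem hG.1).symm ▸ by simp
  rw [hGk, ← hc, map_sum]
  refine Ideal.sum_mem _ fun g _ => ?_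
  have hle : κ g + ν g ≤ k := le_trans
    (Finset.single_le_sum (f := fun g => κ g + ν g) (fun _ _ => Nat.zero_le _) (Finset.mem_univ g)) hk
  obtain ⟨m, rfl⟩ : ∃ m, k = m + κ g := ⟨k - κ g, by omega⟩
  rw [smul_eq_mul, hc_mul_right _ _ (hκ g).1]
  refine hν g m (by omega) _ ?_
  rw [mem_pow_idealOfVars_iff']
  intro x hx
  rw [coeff_homogeneousComponent, if_neg (by omega)]

end partF1

section partF2

/-- The cross product of `a` with the coordinates. -/
def crs (a : Fin 3 → MvPolynomial (Fin 3) ℂ) : Fin 3 → MvPolynomial (Fin 3) ℂ :=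
  ![a 1 * X 2 - a 2 * X 1, a 2 * X 0 - a 0 * X 2, a 0 * X 1 - a 1 * X 0]

lemma crs_homog {m : ℕ} {a : Fin 3 → MvPolynomial (Fin 3) ℂ} (ha : ∀ i, (a i).IsHomogeneous m)
    (i : Fin 3) : (crs a i).IsHomogeneous (m + 1) := by
  have h : ∀ i j, (a i * X j).IsHomogeneous (m+1) := fun i j => (ha i).mul (isHomogeneous_X _ _)
  fin_cases i <;> exact (h _ _).sub (h _ _)

variable {d : ℕ} {F : MvPolynomial (Fin 3) ℂ} {a : Fin 3 → MvPolynomial (Fin 3) ℂ}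

lemma crs_dvd (hF : F.IsHomogeneous d) (hsyz : ∑ i, a i * pderiv i F = 0) (i j : Fin 3) :
    F ∣ crs a i * pderiv j F - crs a j * pderiv i F := by
  have heul := hF.sum_X_mul_pderiv
  rw [nsmul_eq_mul] at heul
  simp only [Fin.sum_univ_three] at heul hsyz
  fin_cases i <;> fin_cases j <;> simp only [crs] <;> simp
  · refine ⟨-d * a 2, ?_⟩
    linear_combination -a 2 * heul + X 2 * hsyz
  · refine ⟨d * a 1, ?_⟩
    linear_combination a 1 * heul - X 1 * hsyz
  · refine ⟨d * a 2, ?_⟩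
    linear_combination a 2 * heul - X 2 * hsyz
  · refine ⟨-d * a 0, ?_⟩
    linear_combination -a 0 * heul + X 0 * hsyz
  · refine ⟨-d * a 1, ?_⟩
    linear_combination -a 1 * heul + X 1 * hsyz
  · refine ⟨d * a 0, ?_⟩
    linear_combination a 0 * heul - X 0 * hsyz

lemma crs_van (hF : F.IsHomogeneous d) (hN : ∀ v, Sg F v → (Hs F v).rank = 2)
    (hsyz : ∑ i, a i * pderiv i F = 0) {v : Fin 3 → ℂ} (hv : Sg F v) (i : Fin 3) :
    eval v (crs a i) = 0 := by
  have h1 : (Hs F v).mulVec (fun i => eval v (a i)) = 0 := by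
    ext j
    have := congrArg (fun p => eval v (pderiv j p)) hsyz
    simp only [map_sum, Derivation.leibniz, map_add, smul_eq_mul, map_mul, hv.2, zero_mul, add_zero,
      map_zero] at this
    simp only [Matrix.mulVec, dotProduct, Hs, Matrix.of_apply, Pi.zero_apply]
    rw [← this]
    exact Finset.sum_congr rfl fun j _ => mul_comm _ _
  obtain ⟨c, hc⟩ := hess_ker (hN v hv) hv.1 (hess_mulVec hF hv) h1
  have hc' : ∀ i, eval v (a i) = c * v i := fun i => congrFun hc i
  fin_cases i <;> simp [crs, hc'] <;> ring

lemma jac_homog {k : ℕ} (hd : 1 ≤ d) (hF : F.IsHomogeneous d) {G : MvPolynomial (Fin 3) ℂ}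
    (hG : G.IsHomogeneous (k + (d - 1))) (h : G ∈ Jac F) :
    ∃ b : Fin 3 → MvPolynomial (Fin 3) ℂ, (∀ i, (b i).IsHomogeneous k) ∧ G = ∑ i, b i * pderiv i F := by
  obtain ⟨c, hc⟩ := (Ideal.mem_span_range_iff_exists_fun).1 h
  refine ⟨fun i => homogeneousComponent k (c i), fun i => homogeneousComponent_isHomogeneous _ _, ?_⟩
  have hGk : G = homogeneousComponent (k + (d-1)) G := (homogeneousComponent_of_mem hG).symm ▸ by simp
  rw [hGk, ← hc, map_sum]
  exact Finset.sum_congr rfl fun i _ => hc_mul_right _ _ hF.pderiv k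

lemma no_syz_s9 (hd : 3 ≤ d) (hF : F.IsHomogeneous d) (hirr : Irreducible F)
    (hN : ∀ v, Sg F v → (Hs F v).rank = 2) (ha : ∀ i, (a i).IsHomogeneous (d - 2))
    (hsyz : ∑ i, a i * pderiv i F = 0) : ∀ i, a i = 0 := by
  have hprime : Prime F := hirr.prime
  obtain ⟨i0, hi0⟩ : ∃ i, pderiv i F ≠ 0 := by
    by_contra! hcon
    exact no_common_factor (by omega) hF hirr hirr (fun i => by rw [hcon i]; exact dvd_zero _)
  have hw : ∀ i, (crs a i).IsHomogeneous (d - 1) := fun i => by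
    have := crs_homog ha i
    rwa [show d - 2 + 1 = d - 1 by omega] at this
  obtain ⟨K, hK⟩ := Vz_le_jac hF hN
  have hpI : (Ideal.span {F}).IsPrime := (Ideal.span_singleton_prime hprime.ne_zero).2 hprime
  let B := MvPolynomial (Fin 3) ℂ ⧸ Ideal.span {F}
  let L := FractionRing B
  let ψ : MvPolynomial (Fin 3) ℂ →ₐ[ℂ] L :=
    (IsScalarTower.toAlgHom ℂ B L).comp (Ideal.Quotient.mkₐ ℂ (Ideal.span {F}))
  have hψ : ∀ G, ψ G = 0 ↔ F ∣ G := by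
    intro G
    have h1 : ψ G = algebraMap B L (Ideal.Quotient.mk _ G) := rfl
    rw [h1, FaithfulSMul.algebraMap_eq_zero_iff, Ideal.Quotient.eq_zero_iff_mem,
      Ideal.mem_span_singleton]
  have hnd : ¬ F ∣ pderiv i0 F := fun h => hi0 (dvd_homog_lt hF hF.pderiv (by omega) h)
  have hψ0 : ψ (pderiv i0 F) ≠ 0 := fun h => hnd ((hψ _).1 h)
  let f : L := ψ (crs a i0) / ψ (pderiv i0 F)
  have hf : ∀ j, f * ψ (pderiv j F) = ψ (crs a j) := by
    intro j
    have h1 := (hψ _).2 (crs_dvd hF hsyz i0 j)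
    rw [map_sub, map_mul, map_mul, sub_eq_zero] at h1
    simp only [f]
    rw [div_mul_eq_mul_div, h1, mul_div_assoc, div_self hψ0, mul_one]
  -- the module
  let V : Submodule ℂ (MvPolynomial (Fin 3) ℂ) :=
    { carrier := {G | Vz F (K + (d - 1)) G}
      add_mem' := fun {x y} hx hy => ⟨hx.1.add hy.1, fun v hv => by
        rw [map_add, hx.2 v hv, hy.2 v hv, add_zero]⟩
      zero_mem' := ⟨isHomogeneous_zero _ _ _, fun v _ => map_zero _⟩
      smul_mem' := fun c x hx => ⟨(homogeneousSubmodule (Fin 3) ℂ _).smul_mem c hx.1, fun v hv => by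
        rw [smul_eval, hx.2 v hv, mul_zero]⟩ }
  have hVle : V ≤ homogeneousSubmodule (Fin 3) ℂ (K + (d-1)) := fun x hx => hx.1
  have hVfg : V.FG := by
    have : FiniteDimensional ℂ V := Submodule.finiteDimensional_of_le hVle
    exact Module.Finite.iff_fg.1 this
  have hfint : IsIntegral ℂ f := by
    refine isIntegral_of_smul_mem_submodule (M := L) (V.map ψ.toLinearMap) ?_ (hVfg.map _) f ?_
    · intro hbot
      have hmem : X 0 ^ K * pderiv i0 F ∈ V := by
        refine ⟨?_, fun v hv => by rw [map_mul, hv.2, mul_zero]⟩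
        refine IsHomogeneous.mul ?_ hF.pderiv
        simpa using (isHomogeneous_X ℂ (0 : Fin 3)).pow K
      have h1 : ψ (X 0 ^ K * pderiv i0 F) ∈ V.map ψ.toLinearMap := ⟨_, hmem, rfl⟩
      rw [hbot, Submodule.mem_bot, hψ] at h1
      rcases hprime.dvd_or_dvd h1 with h2 | h2
      · have h3 := hprime.dvd_of_dvd_pow h2
        exact X_ne_zero (0 : Fin 3) (dvd_homog_lt hF (isHomogeneous_X ℂ (0 : Fin 3)) (by omega) h3)
      · exact hnd h2
    · rintro _ ⟨G, hG, rfl⟩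
      obtain ⟨b, hb, hGb⟩ := jac_homog (by omega) hF hG.1 (hK _ (by omega) G hG)
      refine ⟨∑ i, b i * crs a i, ⟨?_, ?_⟩, ?_⟩
      · exact IsHomogeneous.sum _ _ _ fun i _ => (hb i).mul (hw i)
      · intro v hv
        rw [map_sum]
        exact Finset.sum_eq_zero fun i _ => by rw [map_mul, crs_van hF hN hsyz hv, mul_zero]
      · simp only [AlgHom.toLinearMap_apply, smul_eq_mul]
        rw [hGb, map_sum, map_sum, Finset.mul_sum]
        refine Finset.sum_congr rfl fun i _ => ?_
        rw [map_mul, map_mul, ← hf]; ring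
  obtain ⟨c, hc⟩ : ∃ c : ℂ, algebraMap ℂ L c = f :=
    IsIntegral.mem_range_algebraMap_of_minpoly_splits (R := ℂ) (K := ℂ) (L := L) hfint
      (IsAlgClosed.splits _)
  have hwc : ∀ j, crs a j = C c * pderiv j F := by
    intro j
    have h1 : ψ (crs a j - C c * pderiv j F) = 0 := by
      rw [map_sub, map_mul, ← hf j, ← hc, algHom_C, sub_self]
    have h2 := (hψ _).1 h1
    refine sub_eq_zero.1 (dvd_homog_lt (k := d - 1) hF ((hw j).sub ?_) (by omega) h2)
    simpa using (isHomogeneous_C _ c).mul hF.pderiv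
  have heul := hF.sum_X_mul_pderiv
  have hdne : (d : MvPolynomial (Fin 3) ℂ) ≠ 0 := by exact_mod_cast (by omega : d ≠ 0)
  rw [nsmul_eq_mul] at heul
  have hcz : C c = (0 : MvPolynomial (Fin 3) ℂ) := by
    have h1 : ∑ j, X j * crs a j = 0 := by
      simp [Fin.sum_univ_three, crs]; ring
    have h2 : C c * ((d : MvPolynomial (Fin 3) ℂ) * F) = 0 := by
      rw [← heul, ← h1, Finset.mul_sum]
      refine Finset.sum_congr rfl fun j _ => ?_
      rw [hwc j]; ring
    rcases mul_eq_zero.1 h2 with h | h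
    · exact h
    · exact absurd h (mul_ne_zero hdne hprime.ne_zero)
  have h0 : crs a 0 = 0 := by rw [hwc, hcz, zero_mul]
  have h1 : crs a 1 = 0 := by rw [hwc, hcz, zero_mul]
  have h2 : crs a 2 = 0 := by rw [hwc, hcz, zero_mul]
  simp only [crs] at h0 h1 h2
  simp at h0 h1 h2
  simp only [Fin.sum_univ_three] at heul hsyz
  have hfin : ∀ x : MvPolynomial (Fin 3) ℂ, x * (d * F) = 0 → x = 0 := fun x hx => by
    rcases mul_eq_zero.1 hx with h | h
    · exact h
    · exact absurd h (mul_ne_zero hdne hprime.ne_zero)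
  intro i
  fin_cases i
  · apply hfin
    show a 0 * (d * F) = 0
    linear_combination -a 0 * heul + X 0 * hsyz + pderiv 1 F * h2 - pderiv 2 F * h1
  · apply hfin
    show a 1 * (d * F) = 0
    linear_combination -a 1 * heul + X 1 * hsyz - pderiv 0 F * h2 + pderiv 2 F * h0
  · apply hfin
    show a 2 * (d * F) = 0
    linear_combination -a 2 * heul + X 2 * hsyz + pderiv 0 F * h1 - pderiv 1 F * h0

end partF2

section partG

lemma eval_smul_h {k : ℕ} {G : MvPolynomial (Fin 3) ℂ} (hG : G.IsHomogeneous k) (c : ℂ)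
    (v : Fin 3 → ℂ) : eval (c • v) G = c ^ k * eval v G := by
  have := eval_smul_homog hG c v
  rw [aeval_eq_eval, aeval_eq_eval] at this
  exact this

lemma hess_of_nodal {d : ℕ} {F : MvPolynomial (Fin 3) ℂ}
    (hF : F.IsHomogeneous d) (hnodal : Nodal F) (v : Fin 3 → ℂ) (hv : Sg F v) :
    (Hs F v).rank = 2 := by
  obtain ⟨c, hc⟩ := Projectivization.exists_smul_eq_mk_rep ℂ v hv.1
  set p : P2 := Projectivization.mk ℂ v hv.1
  have hc' : p.rep = (c : ℂ) • v := hc.symm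
  have hs : SingPt F p := by
    intro i
    rw [hc', eval_smul_h hF.pderiv, hv.2 i, mul_zero]
  have h2 := (hnodal p hs).2
  have : (Matrix.of fun i j : Fin 3 => eval p.rep (pderiv i (pderiv j F))) =
      (c : ℂ) ^ (d - 1 - 1) • Hs F v := by
    ext i j
    simp only [Matrix.of_apply, Matrix.smul_apply, Hs, smul_eq_mul]
    rw [hc', eval_smul_h hF.pderiv.pderiv]
  rw [this, Matrix.rank_smul_of_mem_nonZeroDivisors] at h2
  · exact h2
  · exact mem_nonZeroDivisors_of_ne_zero (pow_ne_zero _ c.ne_zero)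

lemma sum_fin3 {M : Type*} [AddCommMonoid M] (f : Fin 3 → M) (i : Fin 3) :
    ∑ j, f j = f i + f (i + 1) + f (i + 2) := by
  rw [Fin.sum_univ_three]
  fin_cases i
  · rfl
  · show f 0 + f 1 + f 2 = f 1 + f 2 + f 0
    rw [add_assoc, add_comm]
  · show f 0 + f 1 + f 2 = f 2 + f 0 + f 1
    rw [add_comm, add_assoc]

/-- Evaluation at the nodes. -/
def evn (F : MvPolynomial (Fin 3) ℂ) (k : ℕ) :
    homogeneousSubmodule (Fin 3) ℂ k →ₗ[ℂ] (nodes F → ℂ) :=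
  LinearMap.pi fun p => (aeval (R := ℂ) (Projectivization.rep p.1)).toLinearMap ∘ₗ Submodule.subtype _

lemma evn_apply (F : MvPolynomial (Fin 3) ℂ) (k : ℕ) (G) (p : nodes F) :
    evn F k G p = eval p.1.rep G.1 := by
  simp [evn, aeval_eq_eval]

lemma main_aux {d : ℕ} (hd : 3 ≤ d) {F : MvPolynomial (Fin 3) ℂ}
    (hF : F.IsHomogeneous d) (hirr : Irreducible F) (hnodal : Nodal F)
    (hfin : (nodes F).Finite) :
    ∃ L : MvPolynomial (Fin 3) ℂ, L.IsHomogeneous 1 ∧ (∀ p ∈ nodes F, eval p.rep L ≠ 0) ∧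
      Function.Surjective (evn F (d - 3)) := by
  classical
  have : Fintype (nodes F) := hfin.fintype
  have hN := hess_of_nodal hF hnodal
  obtain ⟨i, t, hP0, hPQ⟩ := exists_PQ (by omega) hF hirr
  set P := pderiv i F with hPdef
  set R := pderiv (i+2) F with hRdef
  set Q := pderiv (i+1) F + C t * R with hQdef
  have hP : P.IsHomogeneous (d-1) := hF.pderiv
  have hR : R.IsHomogeneous (d-1) := hF.pderiv
  have hQ : Q.IsHomogeneous (d-1) := by
    refine hF.pderiv.add ?_
    simpa using (isHomogeneous_C _ t).mul hR
  obtain ⟨s, u, hp0, hpq, hnv⟩ := exists_L' (by omega) hP hQ hP0 hPQ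
  have hsing : ∀ p ∈ nodes F, ∀ j, eval p.rep (pderiv j F) = 0 := fun p hp j => hp.1 j
  have hLn : ∀ p ∈ nodes F, eval p.rep (pL s u) ≠ 0 := by
    intro p hp
    refine hnv p.rep p.rep_nonzero (hsing p hp _) ?_
    simp [hQdef, hRdef, hsing p hp]
  refine ⟨pL s u, pL_homog s u, hLn, ?_⟩
  rw [← LinearMap.range_eq_top]
  by_contra hne
  obtain ⟨f, hf0, hf⟩ := Submodule.exists_le_ker_of_lt_top _ (lt_top_iff_ne_top.2 hne)
  let ℓ : nodes F → ℂ := fun p => eval p.1.rep (pL s u)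
  have hℓ : ∀ p, ℓ p ≠ 0 := fun p => hLn p.1 p.2
  let ph : nodes F → (Fin 3 → ℂ) := fun p => (ℓ p)⁻¹ • p.1.rep
  let lam : nodes F → ℂ := fun p => f (Pi.single p 1)
  have hflam : ∀ x, f x = ∑ p, x p * lam p := by
    intro x
    conv_lhs => rw [← Finset.univ_sum_single x]
    rw [map_sum]
    refine Finset.sum_congr rfl fun p _ => ?_
    rw [← smul_eq_mul, ← map_smul, ← Pi.single_smul, smul_eq_mul, mul_one]
  let mu : nodes F → ℂ := fun p => ℓ p ^ (d - 3) * lam p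
  let φ : MvPolynomial (Fin 3) ℂ →ₗ[ℂ] ℂ := ∑ p, mu p • (aeval (R := ℂ) (ph p)).toLinearMap
  have hφa : ∀ G, φ G = ∑ p, mu p * eval (ph p) G := by
    intro G
    simp [φ, aeval_eq_eval]
  have hphs : ∀ p j, eval (ph p) (pderiv j F) = 0 := by
    intro p j
    rw [eval_smul_h hF.pderiv, hsing p.1 p.2, mul_zero]
  have hφ0 : φ ≠ 0 := by
    intro h0
    have hinj : Function.Injective
        (fun p : nodes F => ((eval (ph p) : MvPolynomial (Fin 3) ℂ →+* ℂ) :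
          MvPolynomial (Fin 3) ℂ →* ℂ)) := by
      intro p q hpq
      have h1 : ph p = ph q := by
        ext j
        have := DFunLike.congr_fun hpq (X j)
        simpa using this
      apply Subtype.ext
      rw [← p.1.mk_rep, ← q.1.mk_rep, Projectivization.mk_eq_mk_iff']
      refine ⟨ℓ p * (ℓ q)⁻¹, ?_⟩
      rw [mul_smul]
      show ℓ p • ph q = _
      rw [← h1]
      exact smul_inv_smul₀ (hℓ p) _
    have hli := (linearIndependent_monoidHom (MvPolynomial (Fin 3) ℂ) ℂ).comp _ hinj
    have hmu := Fintype.linearIndependent_iff.1 hli mu (by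
      ext G
      have h2 := hφa G
      rw [h0] at h2
      simpa using h2.symm)
    apply hf0
    ext p
    have h3 : lam p = 0 := by
      rcases mul_eq_zero.1 (hmu p) with h | h
      · exact absurd h (pow_ne_zero _ (hℓ p))
      · exact h
    simpa [lam] using h3
  have hφP : ∀ G, φ (G * P) = 0 := by
    intro G
    rw [hφa]
    exact Finset.sum_eq_zero fun p _ => by rw [map_mul, hphs]; ring
  have hφR : ∀ G, φ (G * R) = 0 := by
    intro G
    rw [hφa]
    exact Finset.sum_eq_zero fun p _ => by rw [map_mul, hphs]; ring
  have hφQ : ∀ G, φ (G * Q) = 0 := by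
    intro G
    rw [hφa]
    exact Finset.sum_eq_zero fun p _ => by
      rw [map_mul, hQdef, map_add, map_mul, hphs, hphs]; ring
  have hφL : ∀ G, φ (G * pL s u) = φ G := by
    intro G
    rw [hφa, hφa]
    refine Finset.sum_congr rfl fun p _ => ?_
    rw [map_mul, eval_smul_h (pL_homog s u), pow_one]
    have : (ℓ p)⁻¹ * eval p.1.rep (pL s u) = 1 := inv_mul_cancel₀ (hℓ p)
    rw [this, mul_one]
  have hφd : ∀ G, G.IsHomogeneous (d - 1 - 2) → φ G = 0 := by
    intro G hG
    rw [show d - 1 - 2 = d - 3 by omega] at hG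
    have h1 : f (evn F (d-3) ⟨G, hG⟩) = 0 := hf ⟨_, rfl⟩
    rw [hflam] at h1
    rw [hφa, ← h1]
    refine Finset.sum_congr rfl fun p _ => ?_
    rw [eval_smul_h hG, evn_apply]
    have : ℓ p ^ (d-3) * (ℓ p)⁻¹ ^ (d-3) = 1 := by
      rw [← mul_pow, mul_inv_cancel₀ (hℓ p), one_pow]
    simp only [mu]
    linear_combination (lam p * eval p.1.rep G) * this
  obtain ⟨A, hA, hA0, hAR⟩ := core (e := d - 1) (by omega) hP hQ (pL_homog s u) (pL_ne s u)
    (ppi_pio s u) (ppi_pL s u) (pL_dvd s u) (ppi_homog s u) pio_homog hp0 hpq hR φ hφ0 hφP hφQ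
    hφR hφL hφd
  obtain ⟨b, c, hb, hc, hbc⟩ := mem_pair_homog hP hQ (hA.mul hR) hAR
  rw [show d - 1 - 1 = d - 2 by omega] at hA hb hc
  let a : Fin 3 → MvPolynomial (Fin 3) ℂ := fun j => if j = i then b else if j = i + 1 then c
    else C t * c - A
  have e1 : i + 1 ≠ i := by fin_cases i <;> decide
  have e2 : i + 2 ≠ i := by fin_cases i <;> decide
  have e3 : i + 2 ≠ i + 1 := by fin_cases i <;> decide
  have a0 : a i = b := by simp [a]
  have a1 : a (i+1) = c := by simp only [a, if_neg e1, if_true]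
  have a2 : a (i+2) = C t * c - A := by simp only [a, if_neg e2, if_neg e3]
  have htc : (C t * c).IsHomogeneous (d-2) := by simpa using (isHomogeneous_C _ t).mul hc
  have hz := no_syz_s9 (a := a) hd hF hirr hN (by
    intro j
    simp only [a]
    split_ifs
    · exact hb
    · exact hc
    · exact htc.sub hA) (by
    rw [sum_fin3 _ i, a0, a1, a2, ← hPdef, ← hRdef]
    linear_combination -hbc)
  apply hA0
  have z1 := hz (i+1)
  have z2 := hz (i+2)
  rw [a1] at z1
  rw [a2, z1] at z2
  linear_combination -z2

lemma evn_surj {d : ℕ} (hd : 3 ≤ d) {F : MvPolynomial (Fin 3) ℂ}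
    (hF : F.IsHomogeneous d) (hirr : Irreducible F) (hnodal : Nodal F)
    (hfin : (nodes F).Finite) {k : ℕ} (hk : d - 3 ≤ k) : Function.Surjective (evn F k) := by
  obtain ⟨L, hL, hLn, hs⟩ := main_aux hd hF hirr hnodal hfin
  obtain ⟨m, rfl⟩ : ∃ m, k = d - 3 + m := ⟨k - (d-3), by omega⟩
  intro y
  obtain ⟨G, hG⟩ := hs (fun p => y p / eval p.1.rep L ^ m)
  refine ⟨⟨G.1 * L ^ m, IsHomogeneous.mul G.2 (by simpa using hL.pow m)⟩, ?_⟩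
  ext p
  have := congrFun hG p
  rw [evn_apply] at this ⊢
  simp only [map_mul, map_pow]
  rw [this, div_mul_cancel₀]
  exact pow_ne_zero _ (hLn p.1 p.2)

lemma finrank_Vsp {d : ℕ} (hd : 3 ≤ d) {F : MvPolynomial (Fin 3) ℂ}
    (hF : F.IsHomogeneous d) (hirr : Irreducible F) (hnodal : Nodal F)
    (hfin : (nodes F).Finite) {k : ℕ} (hk : d - 3 ≤ k) :
    Module.finrank ℂ (Vsp k (nodes F)) = (k + 2).choose 2 - (nodes F).ncard := by
  classical
  have : Fintype (nodes F) := hfin.fintype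
  have hV : Vsp k (nodes F) = (LinearMap.ker (evn F k)).map (Submodule.subtype _) := by
    ext G
    simp only [Vsp, Submodule.mem_inf, Submodule.mem_map, LinearMap.mem_ker, Submodule.subtype_apply]
    constructor
    · rintro ⟨h1, h2⟩
      refine ⟨⟨G, h1⟩, ?_, rfl⟩
      ext p
      rw [evn_apply]
      exact h2 p.1 p.2
    · rintro ⟨G', h1, rfl⟩
      refine ⟨G'.2, fun p hp => ?_⟩
      have := congrFun h1 ⟨p, hp⟩
      rw [evn_apply] at this
      exact this
  rw [hV, Submodule.finrank_map_subtype_eq]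
  have h1 := LinearMap.finrank_range_add_finrank_ker (evn F k)
  rw [LinearMap.range_eq_top.2 (evn_surj hd hF hirr hnodal hfin hk), finrank_top,
    Module.finrank_fintype_fun_eq_card, finrank_homog, Nat.multichoose_eq] at h1
  have h2 : (nodes F).ncard = Fintype.card (nodes F) := by
    rw [← Nat.card_coe_set_eq, Nat.card_eq_fintype_card]
  have h3 : (3 + k - 1).choose k = (k + 2).choose 2 := by
    rw [show 3 + k - 1 = k + 2 by omega, Nat.choose_symm_add]
  omega

end partG

theorem stmt_9 (d : ℕ) (hd : 3 ≤ d) (F : MvPolynomial (Fin 3) ℂ)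
    (hF : F.IsHomogeneous d) (hirr : Irreducible F) (hnodal : Nodal F)
    (hfin : (nodes F).Finite) :
    (∀ k : ℕ, d - 3 ≤ k →
      Module.finrank ℂ (Vsp k (nodes F)) = (k + 2).choose 2 - (nodes F).ncard) ∧
    Module.finrank ℂ (Vsp (d - 3) (nodes F)) =
      (d - 1).choose 2 - (nodes F).ncard := by
  refine ⟨fun k hk => finrank_Vsp hd hF hirr hnodal hfin hk, ?_⟩
  have := finrank_Vsp hd hF hirr hnodal hfin (le_refl (d - 3))
  rwa [show d - 3 + 2 = d - 1 by omega] at this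

end
end
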